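/- arXiv:1711.03083 — 3 statements merged into one kernel-verified Lean document; each statement's English description precedes it below -/
import Mathlib

section
/- Let n ≥ 1 and let σ : ℤ^n → ℂ satisfy the toroidal symbol estimates of order 0 and be 0-homogeneous on the lattice, i.e. σ(rℓ) = σ(ℓ) for every ℓ ∈ ℤ^n ∖ {0} and every positive integer r. Then any continuous function f : ℝ^n ∖ {0} → ℂ which is 0-homogeneous (f(tξ) = f(ξ) for all t > 0, ξ ≠ 0) and satisfies f(ℓ) = σ(ℓ) for all ℓ ∈ ℤ^n ∖ {0} is in fact infinitely differentiable (C^∞) on ℝ^n ∖ {0}. -/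
open scoped BigOperators

/-- The embedding of the lattice `ℤ^n` into `ℝ^n`. -/
def latt {n : ℕ} (ℓ : Fin n → ℤ) : Fin n → ℝ := fun i => (ℓ i : ℝ)

/-- The Japanese bracket `⟨ℓ⟩ = (1 + |ℓ|²)^{1/2}` of a lattice point. -/
noncomputable def jap {n : ℕ} (ℓ : Fin n → ℤ) : ℝ :=
  Real.sqrt (1 + ∑ i, (ℓ i : ℝ) ^ 2)

/-- The difference operator `Δ_j σ (ℓ) = σ(ℓ + e_j) - σ(ℓ)`. -/
def Delta {n : ℕ} (j : Fin n) (σ : (Fin n → ℤ) → ℂ) : (Fin n → ℤ) → ℂ :=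
  fun ℓ => σ (ℓ + Pi.single j 1) - σ ℓ

/-- The iterated difference operator `Δ^α = Δ_1^{α_1} ⋯ Δ_n^{α_n}`. -/
def DeltaPow {n : ℕ} (α : Fin n → ℕ) (σ : (Fin n → ℤ) → ℂ) : (Fin n → ℤ) → ℂ :=
  (List.ofFn (fun j : Fin n => (Delta j)^[α j])).foldr (· ∘ ·) id σ

/-- `σ : ℤ^n → ℂ` satisfies the toroidal symbol estimates of order `s ∈ ℝ`:
`|Δ^α σ(ℓ)| ≤ C_α ⟨ℓ⟩^{s - |α|}`. -/
def ToroidalSymbol {n : ℕ} (s : ℝ) (σ : (Fin n → ℤ) → ℂ) : Prop :=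
  ∀ α : Fin n → ℕ, ∃ C > 0, ∀ ℓ : Fin n → ℤ,
    ‖DeltaPow α σ ℓ‖ ≤ C * jap ℓ ^ (s - ∑ j, (α j : ℝ))


open Filter Topology

namespace ExtSmooth

/-! ### Almost additive functions on the half line -/

theorem mult_bound {a : ℝ → ℂ} {C δ : ℝ} (hC : 0 ≤ C) (ha0 : a 0 = 0)
    (h : ∀ s t, 0 ≤ s → 0 ≤ t → s < δ → t < δ → ‖a (s + t) - a s - a t‖ ≤ C * (s * t))
    (u : ℝ) (hu : 0 < u) (m : ℕ) (hm : m * u < δ) :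
    ‖a (m * u) - (m : ℝ) • a u‖ ≤ C * (m * u) ^ 2 := by
  induction m with
  | zero => simp [ha0]
  | succ m ih =>
    push_cast at hm ⊢
    have h1 : (m : ℝ) * u < δ := by nlinarith
    have h2 : u < δ := by
      have : 0 ≤ (m : ℝ) * u := by positivity
      nlinarith
    have h3 := ih h1
    have h4 := h (m * u) u (by positivity) hu.le h1 h2
    have e : a (((m : ℝ) + 1) * u) - ((m : ℝ) + 1) • a u =
        (a (m * u + u) - a (m * u) - a u) + (a (m * u) - (m : ℝ) • a u) := by
      rw [add_mul, one_mul, add_smul, one_smul]; ring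
    rw [e]
    refine (norm_add_le _ _).trans ((add_le_add h4 h3).trans ?_)
    have : C * (m * u * u) + C * (m * u) ^ 2 = C * (m * u * u + (m * u) ^ 2) := by ring
    rw [this]
    apply mul_le_mul_of_nonneg_left _ hC
    have : 0 ≤ (m : ℝ) * u * u := by positivity
    nlinarith [sq_nonneg u]

theorem mult_bound' {a : ℝ → ℂ} {C δ : ℝ} (hC : 0 ≤ C) (ha0 : a 0 = 0)
    (h : ∀ s t, 0 ≤ s → 0 ≤ t → s < δ → t < δ → ‖a (s + t) - a s - a t‖ ≤ C * (s * t))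
    (u : ℝ) (hu : 0 < u) (m : ℕ) (hm0 : 0 < m) (hm : m * u < δ) :
    ‖((m * u : ℝ)⁻¹) • a (m * u) - u⁻¹ • a u‖ ≤ C * (m * u) := by
  have h1 := mult_bound hC ha0 h u hu m hm
  have hm' : (0 : ℝ) < m := by exact_mod_cast hm0
  have hp : 0 < (m : ℝ) * u := by positivity
  have e : ((m * u : ℝ)⁻¹) • a (m * u) - u⁻¹ • a u =
      ((m * u : ℝ)⁻¹) • (a (m * u) - (m : ℝ) • a u) := by
    rw [smul_sub, smul_smul]
    congr 2
    field_simp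
  rw [e, norm_smul, Real.norm_eq_abs, abs_of_pos (inv_pos.2 hp)]
  calc _ ≤ (m * u : ℝ)⁻¹ * (C * (m * u) ^ 2) := by gcongr
    _ = _ := by field_simp

theorem quot_bound {a : ℝ → ℂ} {C δ : ℝ} (hC : 0 ≤ C) (ha0 : a 0 = 0)
    (hc : ∀ t, 0 < t → t < δ → ContinuousAt a t)
    (h : ∀ s t, 0 ≤ s → 0 ≤ t → s < δ → t < δ → ‖a (s + t) - a s - a t‖ ≤ C * (s * t))
    (s t : ℝ) (hs : 0 < s) (ht : 0 < t) (hsd : s < δ) (htd : t < δ) :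
    ‖s⁻¹ • a s - t⁻¹ • a t‖ ≤ C * (s + t) := by
  have hN : Tendsto (fun k : ℕ => (k : ℝ) + 1) atTop atTop :=
    tendsto_atTop_add_const_right _ _ tendsto_natCast_atTop_atTop
  have hlim0 := (tendsto_nat_floor_mul_div_atTop (R := ℝ) (a := s / t) (by positivity)).comp hN
  set p : ℕ → ℕ := fun k => ⌊s / t * ((k : ℝ) + 1)⌋₊ with hp
  set u : ℕ → ℝ := fun k => t / ((k : ℝ) + 1) with hu
  have hlim : Tendsto (fun k => (p k : ℝ) * u k) atTop (𝓝 s) := by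
    have := hlim0.mul_const t
    rw [div_mul_cancel₀ _ ht.ne'] at this
    refine this.congr fun k => ?_
    simp only [Function.comp, hp, hu]
    ring
  have hL : Tendsto (fun k => ‖((p k : ℝ) * u k)⁻¹ • a (p k * u k) - t⁻¹ • a t‖) atTop
      (𝓝 ‖s⁻¹ • a s - t⁻¹ • a t‖) :=
    ((((hlim.inv₀ hs.ne').smul ((hc s hs hsd).tendsto.comp hlim))).sub_const _).norm
  have hR : Tendsto (fun k => C * ((p k : ℝ) * u k + t)) atTop (𝓝 (C * (s + t))) :=
    (hlim.add_const t).const_mul C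
  refine le_of_tendsto_of_tendsto hL hR ?_
  filter_upwards [hlim.eventually (gt_mem_nhds hsd), hlim.eventually (lt_mem_nhds hs)] with k h1 h2
  have hu0 : 0 < u k := by simp only [hu]; positivity
  have hp0 : 0 < p k := by
    rcases Nat.eq_zero_or_pos (p k) with h0 | h0
    · rw [h0] at h2; simp at h2
    · exact h0
  have ht' : ((k + 1 : ℕ) : ℝ) * u k = t := by
    simp only [hu]; push_cast; field_simp
  have b1 := mult_bound' hC ha0 h (u k) hu0 (p k) hp0 h1
  have b2 := mult_bound' hC ha0 h (u k) hu0 (k + 1) k.succ_pos (by rw [ht']; exact htd)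
  rw [ht'] at b2
  rw [norm_sub_rev] at b2
  have := norm_sub_le_norm_sub_add_norm_sub ((p k * u k : ℝ)⁻¹ • a (p k * u k))
    ((u k)⁻¹ • a (u k)) (t⁻¹ • a t)
  linarith

theorem exists_deriv {a : ℝ → ℂ} {C δ : ℝ} (hδ : 0 < δ) (hC : 0 ≤ C) (ha0 : a 0 = 0)
    (hc : ∀ t, 0 < t → t < δ → ContinuousAt a t)
    (h : ∀ s t, 0 ≤ s → 0 ≤ t → s < δ → t < δ → ‖a (s + t) - a s - a t‖ ≤ C * (s * t)) :
    ∃ G : ℂ, Tendsto (fun t : ℝ => t⁻¹ • a t) (𝓝[>] 0) (𝓝 G) ∧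
      ∀ t, 0 < t → t < δ → ‖a t - t • G‖ ≤ C * t ^ 2 := by
  have hq := quot_bound hC ha0 hc h
  have hev : ∀ η : ℝ, 0 < η → ∀ᶠ t : ℝ in 𝓝[>] 0, 0 < t ∧ t < η := fun η hη =>
    Ioo_mem_nhdsGT hη
  have hcau : Cauchy (map (fun t : ℝ => t⁻¹ • a t) (𝓝[>] 0)) := by
    rw [Metric.cauchy_iff]
    refine ⟨inferInstance, fun ε hε => ?_⟩
    have hη : 0 < min δ (ε / (2 * (C + 1))) := by positivity
    refine ⟨_, image_mem_map (hev _ hη), ?_⟩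
    rintro _ ⟨s, ⟨hs, hs'⟩, rfl⟩ _ ⟨t, ⟨ht, ht'⟩, rfl⟩
    rw [dist_eq_norm]
    have hs1 := hs'.trans_le (min_le_right _ _)
    have ht1 := ht'.trans_le (min_le_right _ _)
    rw [lt_div_iff₀ (by positivity)] at hs1 ht1
    refine (hq s t hs ht (hs'.trans_le (min_le_left _ _)) (ht'.trans_le (min_le_left _ _))).trans_lt ?_
    nlinarith
  obtain ⟨G, hG⟩ := cauchy_map_iff_exists_tendsto.1 hcau
  refine ⟨G, hG, fun t ht htd => ?_⟩
  have h1 : ‖t⁻¹ • a t - G‖ ≤ C * t := by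
    have hL := (hG.const_sub (t⁻¹ • a t)).norm
    have hR : Tendsto (fun s : ℝ => C * (t + s)) (𝓝[>] 0) (𝓝 (C * t)) := by
      have : Tendsto (fun s : ℝ => C * (t + s)) (𝓝 0) (𝓝 (C * (t + 0))) :=
        Continuous.tendsto (by fun_prop) 0
      rw [add_zero] at this
      exact this.mono_left nhdsWithin_le_nhds
    refine le_of_tendsto_of_tendsto hL hR ?_
    filter_upwards [hev δ hδ] with s hs
    exact hq t s ht hs.1 htd hs.2
  have e : a t - t • G = t • (t⁻¹ • a t - G) := by
    rw [smul_sub, smul_smul, mul_inv_cancel₀ ht.ne', one_smul]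
  rw [e, norm_smul, Real.norm_eq_abs, abs_of_pos ht]
  nlinarith

/-! ### Iterated finite differences with arbitrary steps -/

/-- Iterated differences of `f` along coordinate directions with given steps. -/
def dl {n : ℕ} : List (Fin n × ℝ) → ((Fin n → ℝ) → ℂ) → (Fin n → ℝ) → ℂ
  | [], f => f
  | p :: L, f => fun x => dl L f (x + Pi.single p.1 p.2) - dl L f x

theorem dl_append {n : ℕ} (L M : List (Fin n × ℝ)) (f : (Fin n → ℝ) → ℂ) :
    dl (L ++ M) f = dl L (dl M f) := by
  induction L with
  | nil => rfl
  | cons p L ih => simp [dl, ih]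

theorem dl_smul {n : ℕ} (L : List (Fin n × ℝ)) (c : ℝ) (f : (Fin n → ℝ) → ℂ)
    (x : Fin n → ℝ) : dl L (fun y => c • f y) x = c • dl L f x := by
  induction L generalizing x with
  | nil => rfl
  | cons p L ih => simp only [dl, ih, smul_sub]

/-- Sum of the steps. -/
def ssum {n : ℕ} (L : List (Fin n × ℝ)) : ℝ := (L.map Prod.snd).sum

/-- Product of the steps. -/
def sprod {n : ℕ} (L : List (Fin n × ℝ)) : ℝ := (L.map Prod.snd).prod

theorem ssum_nonneg {n : ℕ} {L : List (Fin n × ℝ)} (h : ∀ p ∈ L, 0 ≤ p.2) : 0 ≤ ssum L :=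
  List.sum_nonneg (by simpa [ssum] using fun a b hb => h _ hb)

theorem sprod_nonneg {n : ℕ} {L : List (Fin n × ℝ)} (h : ∀ p ∈ L, 0 ≤ p.2) : 0 ≤ sprod L :=
  List.prod_nonneg (by simpa [sprod] using fun a b hb => h _ hb)

theorem ssum_le {n : ℕ} {L : List (Fin n × ℝ)} {δ : ℝ} (h : ∀ p ∈ L, p.2 < δ) :
    ssum L ≤ L.length * δ := by
  have := List.sum_le_card_nsmul (L.map Prod.snd) δ
    (by simpa using fun a b hb => (h _ hb).le)
  simpa [ssum] using this

theorem norm_single_eq {n : ℕ} (j : Fin n) (t : ℝ) :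
    ‖(Pi.single j t : Fin n → ℝ)‖ = |t| := by
  rw [Pi.norm_single, Real.norm_eq_abs]

theorem dl_tendsto {n : ℕ} {ι : Type*} {l : Filter ι} (L : List (Fin n × ℝ))
    (hL : ∀ p ∈ L, 0 ≤ p.2)
    (g : ι → (Fin n → ℝ) → ℂ) (F : (Fin n → ℝ) → ℂ) (x : Fin n → ℝ)
    (h : ∀ y, ‖y - x‖ ≤ ssum L → Tendsto (fun i => g i y) l (𝓝 (F y))) :
    Tendsto (fun i => dl L (g i) x) l (𝓝 (dl L F x)) := by
  induction L generalizing x with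
  | nil => exact h x (by simp [ssum])
  | cons p L ih =>
    have hp : 0 ≤ p.2 := hL p (by simp)
    have hL' : ∀ q ∈ L, 0 ≤ q.2 := fun q hq => hL q (by simp [hq])
    have hs : ssum (p :: L) = p.2 + ssum L := by simp [ssum]
    refine (ih hL' _ fun y hy => h y ?_).sub (ih hL' _ fun y hy => h y ?_)
    · rw [hs]
      have e : y - x = Pi.single p.1 p.2 + (y - (x + Pi.single p.1 p.2)) := by abel
      rw [e]
      refine (norm_add_le _ _).trans ?_
      rw [norm_single_eq, abs_of_nonneg hp]
      linarith
    · rw [hs]; linarith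

/-- Local boundedness of all difference quotients. -/
def PP {n : ℕ} (U : Set (Fin n → ℝ)) (f : (Fin n → ℝ) → ℂ) : Prop :=
  ∀ x0 ∈ U, ∀ J : List (Fin n), ∃ C : ℝ, ∃ δ : ℝ, 0 ≤ C ∧ 0 < δ ∧
    ∀ L : List (Fin n × ℝ), L.map Prod.fst = J → (∀ p ∈ L, 0 ≤ p.2 ∧ p.2 < δ) →
      ∀ x ∈ Metric.ball x0 δ, ‖dl L f x‖ ≤ C * sprod L

theorem exists_partial {n : ℕ} {U : Set (Fin n → ℝ)} (hU : IsOpen U) {f : (Fin n → ℝ) → ℂ}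
    (hf : ContinuousOn f U) (hP : PP U f) (j : Fin n) :
    ∃ F : (Fin n → ℝ) → ℂ,
      (∀ x ∈ U, Tendsto (fun t : ℝ => t⁻¹ • (f (x + Pi.single j t) - f x)) (𝓝[>] 0) (𝓝 (F x))) ∧
      ∀ x0 ∈ U, ∃ C δ : ℝ, 0 ≤ C ∧ 0 < δ ∧ ∀ x ∈ Metric.ball x0 δ, ∀ t, 0 < t → t < δ →
        ‖f (x + Pi.single j t) - f x - t • F x‖ ≤ C * t ^ 2 := by
  have key : ∀ x0 ∈ U, ∃ C δ : ℝ, 0 ≤ C ∧ 0 < δ ∧ Metric.ball x0 δ ⊆ U ∧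
      ∀ x ∈ Metric.ball x0 δ, ∃ G : ℂ,
      Tendsto (fun t : ℝ => t⁻¹ • (f (x + Pi.single j t) - f x)) (𝓝[>] 0) (𝓝 G) ∧
      ∀ t, 0 < t → t < δ → ‖f (x + Pi.single j t) - f x - t • G‖ ≤ C * t ^ 2 := by
    intro x0 hx0
    obtain ⟨C, δ₁, hC, hδ₁, h⟩ := hP x0 hx0 [j, j]
    obtain ⟨ε, hε, hball⟩ := Metric.isOpen_iff.1 hU x0 hx0
    refine ⟨C, min δ₁ (ε / 2), hC, by positivity, ?_, fun x hx => ?_⟩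
    · exact (Metric.ball_subset_ball ((min_le_right _ _).trans (by linarith))).trans hball
    · have hx' : x ∈ Metric.ball x0 δ₁ := Metric.ball_subset_ball (min_le_left _ _) hx
      have hc : ∀ t, 0 < t → t < min δ₁ (ε / 2) →
          ContinuousAt (fun t : ℝ => f (x + Pi.single j t) - f x) t := by
        intro t ht htd
        have hmem : x + Pi.single j t ∈ U := by
          apply hball
          rw [Metric.mem_ball, dist_eq_norm] at hx ⊢
          have e : x + Pi.single j t - x0 = (x - x0) + Pi.single j t := by abel
          rw [e]
          refine (norm_add_le _ _).trans_lt ?_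
          rw [norm_single_eq, abs_of_pos ht]
          have := htd.trans_le (min_le_right _ _)
          have := hx.trans_le (min_le_right _ _)
          linarith
        have h1 : ContinuousAt f (x + Pi.single j t) := hf.continuousAt (hU.mem_nhds hmem)
        have h2 : ContinuousAt (fun t : ℝ => x + (Pi.single j t : Fin n → ℝ)) t :=
          (continuous_const.add (continuous_single j)).continuousAt
        have h3 : ContinuousAt (fun t : ℝ => f (x + (Pi.single j t : Fin n → ℝ))) t :=
          ContinuousAt.comp' h1 h2
        exact h3.sub continuousAt_const
      have hadd : ∀ s t, 0 ≤ s → 0 ≤ t → s < min δ₁ (ε / 2) → t < min δ₁ (ε / 2) →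
          ‖(fun t : ℝ => f (x + Pi.single j t) - f x) (s + t) -
            (fun t : ℝ => f (x + Pi.single j t) - f x) s -
            (fun t : ℝ => f (x + Pi.single j t) - f x) t‖ ≤ C * (s * t) := by
        intro s t hs ht hsd htd
        have := h [(j, s), (j, t)] rfl (by
          intro p hp
          simp only [List.mem_cons, List.not_mem_nil, or_false] at hp
          rcases hp with rfl | rfl
          · exact ⟨hs, hsd.trans_le (min_le_left _ _)⟩
          · exact ⟨ht, htd.trans_le (min_le_left _ _)⟩) x hx'
        simp only [dl, sprod, List.map, List.prod_cons, List.prod_nil, mul_one] at this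
        have e : (fun t : ℝ => f (x + Pi.single j t) - f x) (s + t) -
            (fun t : ℝ => f (x + Pi.single j t) - f x) s -
            (fun t : ℝ => f (x + Pi.single j t) - f x) t =
            f (x + Pi.single j s + Pi.single j t) - f (x + Pi.single j s) -
              (f (x + Pi.single j t) - f x) := by
          simp only [Pi.single_add, add_assoc]
          ring
        rw [e]
        exact this
      have h00 : (fun t : ℝ => f (x + Pi.single j t) - f x) 0 = 0 := by
        simp only [Pi.single_zero, add_zero, sub_self]
      have hres := exists_deriv (lt_min hδ₁ (half_pos hε)) hC h00 hc hadd
      exact hres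
  choose! C δ hC hδ hsub G hG1 hG2 using key
  choose F hF using fun x : Fin n → ℝ => show ∃ G : ℂ, x ∈ U →
      Tendsto (fun t : ℝ => t⁻¹ • (f (x + Pi.single j t) - f x)) (𝓝[>] 0) (𝓝 G) by
    by_cases hx : x ∈ U
    · exact ⟨_, fun _ => hG1 x hx x (Metric.mem_ball_self (hδ x hx))⟩
    · exact ⟨0, fun h => absurd h hx⟩
  refine ⟨F, hF, fun x0 hx0 => ⟨C x0, δ x0, hC _ hx0, hδ _ hx0, fun x hx t ht htd => ?_⟩⟩
  rw [tendsto_nhds_unique (hF x (hsub x0 hx0 hx)) (hG1 x0 hx0 x hx)]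
  exact hG2 x0 hx0 x hx t ht htd

theorem continuousOn_single_shift {n : ℕ} {U : Set (Fin n → ℝ)} (hU : IsOpen U)
    {f : (Fin n → ℝ) → ℂ} (hf : ContinuousOn f U) {x v : Fin n → ℝ} (h : x + v ∈ U) :
    ContinuousAt (fun y => f (y + v)) x := by
  have h1 : ContinuousAt f (x + v) := hf.continuousAt (hU.mem_nhds h)
  have h2 : ContinuousAt (fun y : Fin n → ℝ => y + v) x := by fun_prop
  exact ContinuousAt.comp' h1 h2

theorem partial_continuous {n : ℕ} {U : Set (Fin n → ℝ)} (hU : IsOpen U) {f : (Fin n → ℝ) → ℂ}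
    (hf : ContinuousOn f U) (j : Fin n) (F : (Fin n → ℝ) → ℂ)
    (hF : ∀ x0 ∈ U, ∃ C δ : ℝ, 0 ≤ C ∧ 0 < δ ∧ ∀ x ∈ Metric.ball x0 δ, ∀ t, 0 < t → t < δ →
        ‖f (x + Pi.single j t) - f x - t • F x‖ ≤ C * t ^ 2) :
    ContinuousOn F U := by
  intro x0 hx0
  apply ContinuousAt.continuousWithinAt
  apply continuousAt_of_locally_uniform_approx_of_continuousAt
  intro u hu
  obtain ⟨ε, hε, hεu⟩ := Metric.mem_uniformity_dist.1 hu
  obtain ⟨C, δ, hC, hδ, h⟩ := hF x0 hx0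
  obtain ⟨r, hr, hball⟩ := Metric.isOpen_iff.1 hU x0 hx0
  obtain ⟨t, ht, ht'⟩ := exists_between (show 0 < min (min δ r) (ε / (C + 1)) by positivity)
  have htd : t < δ := ht'.trans_le ((min_le_left _ _).trans (min_le_left _ _))
  have htr : t < r := ht'.trans_le ((min_le_left _ _).trans (min_le_right _ _))
  have hte : t < ε / (C + 1) := ht'.trans_le (min_le_right _ _)
  rw [lt_div_iff₀ (by positivity)] at hte
  refine ⟨Metric.ball x0 δ, Metric.ball_mem_nhds _ hδ,
    fun y => t⁻¹ • (f (y + Pi.single j t) - f y), ?_, fun y hy => hεu ?_⟩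
  · have hmem : x0 + Pi.single j t ∈ U := by
      apply hball
      rw [Metric.mem_ball, dist_eq_norm, add_sub_cancel_left, norm_single_eq, abs_of_pos ht]
      exact htr
    exact ((continuousOn_single_shift hU hf hmem).sub
      (hf.continuousAt (hU.mem_nhds hx0))).const_smul t⁻¹
  · have h1 := h y hy t ht htd
    rw [dist_comm, dist_eq_norm]
    have e : t⁻¹ • (f (y + Pi.single j t) - f y) - F y =
        t⁻¹ • (f (y + Pi.single j t) - f y - t • F y) := by
      rw [smul_sub t⁻¹ _ (t • F y), smul_smul, inv_mul_cancel₀ ht.ne', one_smul]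
    rw [e, norm_smul, Real.norm_eq_abs, abs_of_pos (inv_pos.2 ht)]
    calc _ ≤ t⁻¹ * (C * t ^ 2) := by gcongr
      _ = C * t := by field_simp
      _ < ε := by nlinarith

theorem partial_PP {n : ℕ} {U : Set (Fin n → ℝ)} (hU : IsOpen U) {f : (Fin n → ℝ) → ℂ}
    (hP : PP U f) (j : Fin n) (F : (Fin n → ℝ) → ℂ)
    (hF : ∀ x ∈ U, Tendsto (fun t : ℝ => t⁻¹ • (f (x + Pi.single j t) - f x)) (𝓝[>] 0)
      (𝓝 (F x))) : PP U F := by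
  intro x0 hx0 J
  obtain ⟨C, δ, hC, hδ, h⟩ := hP x0 hx0 (J ++ [j])
  obtain ⟨r, hr, hball⟩ := Metric.isOpen_iff.1 hU x0 hx0
  have hη : 0 < min δ (r / (J.length + 1)) := by positivity
  refine ⟨C, min δ (r / (J.length + 1)), hC, hη, fun L hLJ hL x hx => ?_⟩
  have hlen : L.length = J.length := by rw [← hLJ, List.length_map]
  have hL0 : ∀ p ∈ L, 0 ≤ p.2 := fun p hp => (hL p hp).1
  have hmem : ∀ y, ‖y - x‖ ≤ ssum L → y ∈ U := by
    intro y hy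
    apply hball
    have h1 := ssum_le (fun p hp => (hL p hp).2)
    rw [hlen] at h1
    rw [Metric.mem_ball, dist_eq_norm] at hx ⊢
    have h2 := norm_add_le (y - x) (x - x0)
    rw [sub_add_sub_cancel] at h2
    have h3 : min δ (r / (J.length + 1)) * (J.length + 1) ≤ r := by
      rw [← le_div_iff₀ (by positivity)]
      exact min_le_right _ _
    nlinarith
  obtain ⟨g, hg⟩ : ∃ g : ℝ → (Fin n → ℝ) → ℂ,
      ∀ t, g t = fun y => t⁻¹ • dl [(j, t)] f y := ⟨_, fun t => rfl⟩
  have hlim := dl_tendsto (l := 𝓝[>] (0 : ℝ)) L hL0 g F x (fun y hy => by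
    refine (hF y (hmem y hy)).congr fun t => ?_
    rw [hg]; rfl)
  · refine le_of_tendsto hlim.norm ?_
    filter_upwards [Ioo_mem_nhdsGT hδ] with t ht
    have hb := h (L ++ [(j, t)]) (by simp [hLJ]) (by
      intro p hp
      rcases List.mem_append.1 hp with hp | hp
      · exact ⟨(hL p hp).1, (hL p hp).2.trans_le (min_le_left _ _)⟩
      · rw [List.mem_singleton] at hp
        subst hp
        exact ⟨ht.1.le, ht.2⟩) x (Metric.ball_subset_ball (min_le_left _ _) hx)
    rw [dl_append] at hb
    have hs : sprod (L ++ [(j, t)]) = sprod L * t := by simp [sprod]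
    rw [hs] at hb
    rw [hg, dl_smul, norm_smul, Real.norm_eq_abs, abs_of_pos (inv_pos.2 ht.1)]
    have ht0 := ht.1
    calc _ ≤ t⁻¹ * (C * (sprod L * t)) := by
          apply mul_le_mul_of_nonneg_left _ (inv_pos.2 ht0).le
          exact hb
      _ = C * sprod L := by field_simp

theorem two_sided {n : ℕ} {U : Set (Fin n → ℝ)} {f : (Fin n → ℝ) → ℂ}
    (j : Fin n) (F : (Fin n → ℝ) → ℂ) (hPF : PP U F)
    (hF : ∀ x0 ∈ U, ∃ C δ : ℝ, 0 ≤ C ∧ 0 < δ ∧ ∀ x ∈ Metric.ball x0 δ, ∀ t, 0 < t → t < δ →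
        ‖f (x + Pi.single j t) - f x - t • F x‖ ≤ C * t ^ 2)
    (x0 : Fin n → ℝ) (hx0 : x0 ∈ U) :
    ∃ C δ : ℝ, 0 ≤ C ∧ 0 < δ ∧ ∀ x ∈ Metric.ball x0 δ, ∀ t, |t| < δ →
        ‖f (x + Pi.single j t) - f x - t • F x‖ ≤ C * t ^ 2 := by
  obtain ⟨C, δ, hC, hδ, h⟩ := hF x0 hx0
  obtain ⟨C', δ', hC', hδ', h'⟩ := hPF x0 hx0 [j]
  have hη : 0 < min δ δ' / 2 := by positivity
  refine ⟨C + C', min δ δ' / 2, by positivity, hη, fun x hx t ht => ?_⟩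
  have m1 := min_le_left δ δ'
  have m2 := min_le_right δ δ'
  rcases lt_trichotomy t 0 with ht0 | rfl | ht0
  · rw [abs_of_neg ht0] at ht
    set y := x + Pi.single j t with hy
    have hyx : y + Pi.single j (-t) = x := by
      rw [hy, add_assoc, ← Pi.single_add]; simp
    have hyb : y ∈ Metric.ball x0 (min δ δ') := by
      rw [Metric.mem_ball, dist_eq_norm] at hx ⊢
      have e : y - x0 = (x - x0) + Pi.single j t := by rw [hy]; abel
      rw [e]
      refine (norm_add_le _ _).trans_lt ?_
      rw [norm_single_eq, abs_of_neg ht0]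
      linarith
    have b1 := h y (Metric.ball_subset_ball m1 hyb) (-t) (by linarith) (by linarith)
    have b2 := h' [(j, -t)] rfl (by
      intro p hp
      rw [List.mem_singleton] at hp
      subst hp
      exact ⟨by simp only; linarith, by simp only; linarith⟩) y (Metric.ball_subset_ball m2 hyb)
    simp only [dl, sprod, List.map, List.prod_cons, List.prod_nil, mul_one, hyx] at b2
    rw [hyx] at b1
    have e : f y - f x - t • F x = -(f x - f y - (-t) • F y) + (-t) • (F x - F y) := by
      simp only [smul_sub, neg_smul]; abel
    rw [e]
    refine (norm_add_le _ _).trans ?_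
    rw [norm_neg, norm_smul, Real.norm_eq_abs, abs_of_pos (by linarith : 0 < -t)]
    nlinarith
  · simp
  · rw [abs_of_pos ht0] at ht
    have := h x (Metric.ball_subset_ball (by linarith) hx) t ht0 (by linarith)
    nlinarith [sq_nonneg t]

theorem has_fderiv {n : ℕ} {f : (Fin n → ℝ) → ℂ} (F : Fin n → (Fin n → ℝ) → ℂ) (x : Fin n → ℝ)
    (hc : ∀ j, ContinuousAt (F j) x)
    (h : ∀ j, ∃ C δ : ℝ, 0 ≤ C ∧ 0 < δ ∧ ∀ y ∈ Metric.ball x δ, ∀ t, |t| < δ →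
        ‖f (y + Pi.single j t) - f y - t • F j y‖ ≤ C * t ^ 2) :
    HasFDerivAt f (∑ j, (ContinuousLinearMap.proj (R := ℝ) (φ := fun _ : Fin n => ℝ) j).smulRight
      (F j x)) x := by
  have key : ∀ s : Finset (Fin n), (fun v : Fin n → ℝ =>
      f (x + ∑ j ∈ s, Pi.single j (v j)) - f x - ∑ j ∈ s, v j • F j x) =o[𝓝 0] fun v => v := by
    intro s
    induction s using Finset.induction_on with
    | empty => simp
    | insert a s ha ih =>
      obtain ⟨C, δ, hC, hδ, hb⟩ := h a
      set w : (Fin n → ℝ) → (Fin n → ℝ) := fun v => x + ∑ j ∈ s, Pi.single j (v j) with hw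
      have hwc : Continuous w := by
        refine continuous_const.add (continuous_finsetSum _ fun j _ => ?_)
        exact (continuous_single j).comp (continuous_apply j)
      have hw0 : w 0 = x := by simp [hw]
      have hwt : Tendsto w (𝓝 0) (𝓝 x) := by
        have := hwc.tendsto 0
        rwa [hw0] at this
      have hnv : Tendsto (fun v : Fin n → ℝ => ‖v‖) (𝓝 0) (𝓝 0) := by
        have := (continuous_norm (E := Fin n → ℝ)).tendsto 0
        rwa [norm_zero] at this
      have h1 : (fun v : Fin n → ℝ => f (w v + Pi.single a (v a)) - f (w v) - v a • F a (w v))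
          =o[𝓝 0] fun v => v := by
        rw [Asymptotics.isLittleO_iff]
        intro c hcpos
        have hcc : 0 < c / (C + 1) := by positivity
        filter_upwards [hwt.eventually (Metric.ball_mem_nhds x hδ), hnv.eventually (gt_mem_nhds hδ),
          hnv.eventually (gt_mem_nhds hcc)] with v v1 v2 v3
        have hva : |v a| ≤ ‖v‖ := by
          rw [← Real.norm_eq_abs]; exact norm_le_pi_norm v a
        refine (hb _ v1 (v a) (hva.trans_lt v2)).trans ?_
        rw [lt_div_iff₀ (by positivity)] at v3
        rw [← sq_abs]
        have : |v a| ^ 2 ≤ ‖v‖ ^ 2 := by gcongr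
        have h0 := norm_nonneg v
        calc C * |v a| ^ 2 ≤ C * ‖v‖ ^ 2 := by gcongr
          _ ≤ (‖v‖ * (C + 1)) * ‖v‖ := by nlinarith
          _ ≤ c * ‖v‖ := by gcongr
      have h2 : (fun v : Fin n → ℝ => v a • (F a (w v) - F a x)) =o[𝓝 0] fun v => v := by
        rw [Asymptotics.isLittleO_iff]
        intro c hcpos
        have := ((hc a).tendsto.comp hwt).eventually (Metric.ball_mem_nhds _ hcpos)
        filter_upwards [this] with v hv
        rw [dist_eq_norm] at hv
        rw [norm_smul, mul_comm]
        exact mul_le_mul hv.le (norm_le_pi_norm v a) (norm_nonneg _) hcpos.le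
      refine ((ih.add h1).add h2).congr_left fun v => ?_
      rw [Finset.sum_insert ha, Finset.sum_insert ha, smul_sub,
        add_comm (Pi.single a (v a) : Fin n → ℝ), ← add_assoc]
      simp only [hw]
      abel
  rw [hasFDerivAt_iff_isLittleO_nhds_zero]
  refine (key Finset.univ).congr_left fun v => ?_
  rw [Finset.univ_sum_single]
  simp

theorem smooth_of_PP {n : ℕ} {U : Set (Fin n → ℝ)} (hU : IsOpen U) (k : ℕ) :
    ∀ f : (Fin n → ℝ) → ℂ, ContinuousOn f U → PP U f → ContDiffOn ℝ k f U := by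
  induction k with
  | zero => intro f hf _; exact contDiffOn_zero.2 hf
  | succ k ih =>
    intro f hf hP
    choose F hF1 hF2 using exists_partial hU hf hP
    have hFc := fun j => partial_continuous hU hf j (F j) (hF2 j)
    have hFP := fun j => partial_PP hU hP j (F j) (hF1 j)
    push_cast
    rw [contDiffOn_succ_iff_hasFDerivWithinAt_of_uniqueDiffOn hU.uniqueDiffOn]
    refine ⟨fun h => by simp at h, fun x => ∑ j, (ContinuousLinearMap.proj (R := ℝ)
      (φ := fun _ : Fin n => ℝ) j).smulRight (F j x), ?_, fun x hx => ?_⟩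
    · refine ContDiffOn.sum fun j _ => ?_
      exact contDiffOn_const.smulRight (ih (F j) (hFc j) (hFP j))
    · exact (has_fderiv F x (fun j => (hFc j).continuousAt (hU.mem_nhds hx))
        (fun j => two_sided j (F j) (hFP j) (hF2 j) x hx)).hasFDerivWithinAt

/-! ### The lattice side -/

/-- Iterated differences with integer steps. -/
def dlZ {n : ℕ} : List (Fin n × ℕ) → ((Fin n → ℤ) → ℂ) → (Fin n → ℤ) → ℂ
  | [], f => f
  | p :: L, f => fun x => dlZ L f (x + Pi.single p.1 (p.2 : ℤ)) - dlZ L f x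

/-- Iterated unit differences. -/
def dl1 {n : ℕ} : List (Fin n) → ((Fin n → ℤ) → ℂ) → (Fin n → ℤ) → ℂ
  | [], f => f
  | j :: L, f => dl1 L (Delta j f)

theorem dlZ_Delta {n : ℕ} (j : Fin n) (M : List (Fin n × ℕ)) (σ : (Fin n → ℤ) → ℂ)
    (x : Fin n → ℤ) : dlZ M (Delta j σ) x = Delta j (dlZ M σ) x := by
  induction M generalizing x with
  | nil => rfl
  | cons p M ih =>
    simp only [dlZ, ih, Delta]
    rw [add_right_comm]
    ring

theorem norm_latt_single {n : ℕ} (j : Fin n) (i : ℕ) :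
    ‖latt (Pi.single j (i : ℤ) : Fin n → ℤ)‖ = i := by
  have : latt (Pi.single j (i : ℤ) : Fin n → ℤ) = Pi.single j (i : ℝ) := by
    ext k
    by_cases h : k = j
    · subst h; simp [latt]
    · simp [latt, h]
  rw [this, norm_single_eq]; simp

theorem latt_add {n : ℕ} (a b : Fin n → ℤ) : latt (a + b) = latt a + latt b := by
  ext k; simp [latt]

theorem telescope {n : ℕ} (j : Fin n) (g : (Fin n → ℤ) → ℂ) (x : Fin n → ℤ) (H : ℕ) :
    g (x + Pi.single j (H : ℤ)) - g x =
      ∑ i ∈ Finset.range H, Delta j g (x + Pi.single j (i : ℤ)) := by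
  induction H with
  | zero => simp
  | succ H ih =>
    rw [Finset.sum_range_succ, ← ih]
    simp only [Delta]
    rw [add_assoc x, ← Pi.single_add]
    push_cast
    ring

theorem dlZ_bound {n : ℕ} (M : List (Fin n × ℕ)) (σ : (Fin n → ℤ) → ℂ) (x : Fin n → ℤ) (B : ℝ)
    (h : ∀ m, ‖latt m - latt x‖ ≤ (M.map fun p => (p.2 : ℝ)).sum → ‖dl1 (M.map Prod.fst) σ m‖ ≤ B) :
    ‖dlZ M σ x‖ ≤ (M.map fun p => (p.2 : ℝ)).prod * B := by
  induction M generalizing σ x with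
  | nil => simpa [dlZ, dl1] using h x (by simp)
  | cons p M ih =>
    obtain ⟨j, H⟩ := p
    simp only [dlZ]
    rw [telescope, List.map_cons, List.prod_cons, mul_assoc]
    refine (norm_sum_le _ _).trans ?_
    refine (Finset.sum_le_card_nsmul _ _ ((M.map fun p => (p.2 : ℝ)).prod * B)
      fun i hi => ?_).trans (le_of_eq ?_)
    · rw [← dlZ_Delta]
      refine ih _ _ fun m hm => h m ?_
      rw [latt_add] at hm
      have e : latt m - latt x = latt (Pi.single j (i : ℤ)) +
        (latt m - (latt x + latt (Pi.single j (i : ℤ)))) := by abel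
      rw [e]
      refine (norm_add_le _ _).trans ?_
      rw [norm_latt_single, List.map_cons, List.sum_cons]
      have : (i : ℝ) ≤ H := by exact_mod_cast (Finset.mem_range.1 hi).le
      simp only
      linarith
    · simp

theorem fold_update {X : Type*} : ∀ (n : ℕ) (A A' : Fin n → X → X) (D : X → X) (j : Fin n),
    (∀ i x, A i (D x) = D (A i x)) → A' j = A j ∘ D → (∀ i, i ≠ j → A' i = A i) →
    ∀ x, (List.ofFn A').foldr (· ∘ ·) id x = (List.ofFn A).foldr (· ∘ ·) id (D x) := by
  intro n
  induction n with
  | zero => intro A A' D j; exact j.elim0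
  | succ n ih =>
    intro A A' D j hcomm hj hne x
    have hfold : ∀ (m : ℕ) (B : Fin m → X → X), (∀ i x, B i (D x) = D (B i x)) → ∀ x,
        (List.ofFn B).foldr (· ∘ ·) id (D x) = D ((List.ofFn B).foldr (· ∘ ·) id x) := by
      intro m
      induction m with
      | zero => intro B _ x; simp
      | succ m ihm =>
        intro B hB x
        simp only [List.ofFn_succ, List.foldr_cons, Function.comp]
        rw [ihm _ (fun i => hB i.succ), hB]
    simp only [List.ofFn_succ, List.foldr_cons, Function.comp]
    rcases Fin.eq_zero_or_eq_succ j with rfl | ⟨k, rfl⟩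
    · have : (fun i : Fin n => A' i.succ) = fun i => A i.succ := by
        funext i; exact hne _ (Fin.succ_ne_zero i)
      rw [this, hj, hfold _ _ (fun i => hcomm i.succ)]
      rfl
    · rw [hne 0 (Fin.succ_ne_zero k).symm,
        ih (fun i => A i.succ) (fun i => A' i.succ) D k (fun i => hcomm i.succ) hj
          (fun i hi => hne _ (by simpa using hi))]

theorem Delta_comm {n : ℕ} (i j : Fin n) (σ : (Fin n → ℤ) → ℂ) :
    Delta i (Delta j σ) = Delta j (Delta i σ) := by
  funext x
  simp only [Delta]
  rw [add_right_comm]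
  ring

theorem DeltaPow_Delta {n : ℕ} (α : Fin n → ℕ) (j : Fin n) (σ : (Fin n → ℤ) → ℂ) :
    DeltaPow (α + Pi.single j 1) σ = DeltaPow α (Delta j σ) := by
  unfold DeltaPow
  apply fold_update n _ _ _ j
  · intro i x
    exact ((Function.Commute.iterate_left (f := Delta i) (g := Delta j)
      (fun σ => Delta_comm i j σ) (α i))) x
  · simp [Function.iterate_succ]
  · intro i hi
    simp [hi]

theorem dl1_eq {n : ℕ} (J : List (Fin n)) : ∃ α : Fin n → ℕ, ∑ j, (α j : ℝ) = J.length ∧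
    ∀ σ, dl1 J σ = DeltaPow α σ := by
  induction J with
  | nil =>
    refine ⟨0, by simp, fun σ => ?_⟩
    have hid : ∀ l : List (((Fin n → ℤ) → ℂ) → ((Fin n → ℤ) → ℂ)), (∀ g ∈ l, g = id) →
        l.foldr (· ∘ ·) id = id := by
      intro l
      induction l with
      | nil => simp
      | cons a l ih =>
        intro h
        rw [List.foldr_cons, ih fun g hg => h g (by simp [hg]), h a (by simp)]
        rfl
    unfold DeltaPow
    rw [hid _ (by simp)]
    rfl
  | cons j J ih =>
    obtain ⟨α, h1, h2⟩ := ih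
    refine ⟨α + Pi.single j 1, ?_, fun σ => ?_⟩
    · simp only [Pi.add_apply, Nat.cast_add, Finset.sum_add_distrib, h1]
      simp [Pi.single_apply]
    · rw [DeltaPow_Delta, ← h2]; rfl

theorem norm_latt_le_jap {n : ℕ} (m : Fin n → ℤ) : ‖latt m‖ ≤ jap m := by
  refine (pi_norm_le_iff_of_nonneg (Real.sqrt_nonneg _)).2 fun i => ?_
  rw [Real.norm_eq_abs]
  apply Real.abs_le_sqrt
  have := Finset.single_le_sum (f := fun i => (m i : ℝ) ^ 2) (fun i _ => sq_nonneg _)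
    (Finset.mem_univ i)
  simp only [latt]
  linarith

theorem dl1_bound {n : ℕ} {σ : (Fin n → ℤ) → ℂ} (hσ : ToroidalSymbol 0 σ) (J : List (Fin n)) :
    ∃ C : ℝ, 0 ≤ C ∧ ∀ (m : Fin n → ℤ) (R : ℝ), 0 < R → R ≤ ‖latt m‖ →
      ‖dl1 J σ m‖ ≤ C * (R ^ J.length)⁻¹ := by
  obtain ⟨α, h1, h2⟩ := dl1_eq J
  obtain ⟨C, hC, h⟩ := hσ α
  refine ⟨C, hC.le, fun m R hR hm => ?_⟩
  rw [h2]
  refine (h m).trans ?_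
  rw [h1, zero_sub, Real.rpow_neg (show 0 ≤ jap m from Real.sqrt_nonneg _), Real.rpow_natCast]
  have := hm.trans (norm_latt_le_jap m)
  gcongr

/-- Rounded steps. -/
noncomputable def rnd {n : ℕ} (N : ℝ) (L : List (Fin n × ℝ)) : List (Fin n × ℕ) :=
  L.map fun p => (p.1, ⌊p.2 * N⌋₊)

/-- Scaling integer steps by `1 / N`. -/
noncomputable def scl {n : ℕ} (N : ℝ) (M : List (Fin n × ℕ)) : List (Fin n × ℝ) :=
  M.map fun p => (p.1, (p.2 : ℝ) / N)

theorem dl_scl {n : ℕ} {f : (Fin n → ℝ) → ℂ} {σ : (Fin n → ℤ) → ℂ} {N : ℝ} (hN : 0 < N)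
    (hfh : ∀ t : ℝ, 0 < t → ∀ ξ : Fin n → ℝ, ξ ≠ 0 → f (t • ξ) = f ξ)
    (hfσ : ∀ ℓ : Fin n → ℤ, ℓ ≠ 0 → f (latt ℓ) = σ ℓ)
    (M : List (Fin n × ℕ)) (x : Fin n → ℤ)
    (h : (M.map fun p => (p.2 : ℝ)).sum < ‖latt x‖) :
    dl (scl N M) f (N⁻¹ • latt x) = dlZ M σ x := by
  induction M generalizing x with
  | nil =>
    have h0 : 0 < ‖latt x‖ := by simpa using h
    have hx : latt x ≠ 0 := norm_pos_iff.1 h0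
    have hx' : x ≠ 0 := by
      rintro rfl; apply hx; ext i; simp [latt]
    simp only [scl, List.map_nil, dl, dlZ]
    rw [hfh _ (inv_pos.2 hN) _ hx, hfσ x hx']
  | cons p M ih =>
    obtain ⟨j, H⟩ := p
    rw [List.map_cons, List.sum_cons] at h
    simp only at h
    have e : N⁻¹ • latt x + Pi.single j ((H : ℝ) / N) =
        N⁻¹ • latt (x + Pi.single j (H : ℤ)) := by
      ext k
      by_cases hk : k = j
      · subst hk; simp [latt]; ring
      · simp [latt, hk]
    have hH : (0 : ℝ) ≤ H := Nat.cast_nonneg H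
    have h2 : ‖latt x‖ ≤ ‖latt (x + Pi.single j (H : ℤ))‖ + H := by
      have := norm_sub_le (latt (x + Pi.single j (H : ℤ))) (latt (Pi.single j (H : ℤ)))
      rwa [norm_latt_single, latt_add, add_sub_cancel_right, ← latt_add] at this
    have e2 : scl N ((j, H) :: M) = (j, (H : ℝ) / N) :: scl N M := rfl
    rw [e2]
    simp only [dl, dlZ]
    rw [e, ih _ (by linarith), ih _ (by linarith)]

theorem dl_cont {n : ℕ} {U : Set (Fin n → ℝ)} (hU : IsOpen U) {f : (Fin n → ℝ) → ℂ}
    (hf : ContinuousOn f U) (L : List (Fin n × ℝ)) (hL : ∀ p ∈ L, 0 ≤ p.2)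
    (N : ℕ → ℝ) (hN : Tendsto N atTop atTop) (y : ℕ → Fin n → ℝ) (x : Fin n → ℝ)
    (hy : Tendsto y atTop (𝓝 x)) (hx : ∀ z, ‖z - x‖ ≤ ssum L → z ∈ U) :
    Tendsto (fun k => dl (scl (N k) (rnd (N k) L)) f (y k)) atTop (𝓝 (dl L f x)) := by
  induction L generalizing x y with
  | nil =>
    have : x ∈ U := hx x (by simp [ssum])
    exact (hf.continuousAt (hU.mem_nhds this)).tendsto.comp hy
  | cons p L ih =>
    have hp : 0 ≤ p.2 := hL p (by simp)
    have hL' : ∀ q ∈ L, 0 ≤ q.2 := fun q hq => hL q (by simp [hq])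
    have hs : ssum (p :: L) = p.2 + ssum L := by simp [ssum]
    have hst : Tendsto (fun k => (⌊p.2 * N k⌋₊ : ℝ) / N k) atTop (𝓝 p.2) :=
      (tendsto_nat_floor_mul_div_atTop hp).comp hN
    have hst' : Tendsto (fun k => y k + (Pi.single p.1 ((⌊p.2 * N k⌋₊ : ℝ) / N k) : Fin n → ℝ))
        atTop (𝓝 (x + Pi.single p.1 p.2)) := by
      have hcs : Continuous (fun t : ℝ => (Pi.single p.1 t : Fin n → ℝ)) :=
        continuous_single (A := fun _ : Fin n => ℝ) p.1
      have h3 : Tendsto (fun k => (Pi.single p.1 ((⌊p.2 * N k⌋₊ : ℝ) / N k) : Fin n → ℝ))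
          atTop (𝓝 (Pi.single p.1 p.2)) := (hcs.tendsto p.2).comp hst
      exact hy.add h3
    have t1 := ih hL' _ _ hst' (fun z hz => hx z (by
      rw [hs]
      have e : z - x = Pi.single p.1 p.2 + (z - (x + Pi.single p.1 p.2)) := by abel
      rw [e]
      refine (norm_add_le _ _).trans ?_
      rw [norm_single_eq, abs_of_nonneg hp]
      linarith))
    have t2 := ih hL' _ _ hy (fun z hz => hx z (by rw [hs]; linarith))
    exact t1.sub t2

theorem sprod_cont {n : ℕ} (L : List (Fin n × ℝ)) (hL : ∀ p ∈ L, 0 ≤ p.2)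
    (N : ℕ → ℝ) (hN : Tendsto N atTop atTop) :
    Tendsto (fun k => sprod (scl (N k) (rnd (N k) L))) atTop (𝓝 (sprod L)) := by
  induction L with
  | nil => simp [sprod, scl, rnd]
  | cons p L ih =>
    have hp : 0 ≤ p.2 := hL p (by simp)
    have hL' : ∀ q ∈ L, 0 ≤ q.2 := fun q hq => hL q (by simp [hq])
    have hst : Tendsto (fun k => (⌊p.2 * N k⌋₊ : ℝ) / N k) atTop (𝓝 p.2) :=
      (tendsto_nat_floor_mul_div_atTop hp).comp hN
    have := hst.mul (ih hL')
    simpa [sprod, scl, rnd] using this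

theorem sprod_scl {n : ℕ} (N : ℝ) (M : List (Fin n × ℕ)) :
    sprod (scl N M) = (M.map fun p => (p.2 : ℝ)).prod * (N ^ M.length)⁻¹ := by
  induction M with
  | nil => simp [sprod, scl]
  | cons p M ih =>
    have : sprod (scl N (p :: M)) = p.2 / N * sprod (scl N M) := by simp [sprod, scl]
    rw [this, ih, List.map_cons, List.prod_cons, List.length_cons, pow_succ, mul_inv]
    ring

theorem rnd_sum_le {n : ℕ} {N : ℝ} (hN : 0 < N) (L : List (Fin n × ℝ)) (hL : ∀ p ∈ L, 0 ≤ p.2) :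
    ((rnd N L).map fun p => (p.2 : ℝ)).sum ≤ ssum L * N := by
  induction L with
  | nil => simp [rnd, ssum]
  | cons p L ih =>
    have hp : 0 ≤ p.2 := hL p (by simp)
    have := ih fun q hq => hL q (by simp [hq])
    have h1 := Nat.floor_le (mul_nonneg hp hN.le)
    have hs : ssum (p :: L) = p.2 + ssum L := by simp [ssum]
    rw [hs]
    have e : ((rnd N (p :: L)).map fun p => (p.2 : ℝ)).sum =
      ⌊p.2 * N⌋₊ + ((rnd N L).map fun p => (p.2 : ℝ)).sum := by simp [rnd]
    rw [e]
    linarith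

theorem base_PP {n : ℕ} {f : (Fin n → ℝ) → ℂ} {σ : (Fin n → ℤ) → ℂ} (hσ : ToroidalSymbol 0 σ)
    (hfc : ContinuousOn f {ξ : Fin n → ℝ | ξ ≠ 0})
    (hfh : ∀ t : ℝ, 0 < t → ∀ ξ : Fin n → ℝ, ξ ≠ 0 → f (t • ξ) = f ξ)
    (hfσ : ∀ ℓ : Fin n → ℤ, ℓ ≠ 0 → f (latt ℓ) = σ ℓ) :
    PP {ξ : Fin n → ℝ | ξ ≠ 0} f := by
  intro x0 hx0 J
  obtain ⟨C, hC, hb⟩ := dl1_bound hσ J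
  have hr : 0 < ‖x0‖ := norm_pos_iff.2 hx0
  set r := ‖x0‖ with hrdef
  set δ := r / (2 * (J.length + 1)) with hδdef
  have hδ : 0 < δ := by positivity
  have hδr : (J.length + 1) * δ = r / 2 := by rw [hδdef]; field_simp
  refine ⟨C * ((r / 2) ^ J.length)⁻¹, δ, by positivity, hδ, fun L hLJ hL x hx => ?_⟩
  have hL0 : ∀ p ∈ L, 0 ≤ p.2 := fun p hp => (hL p hp).1
  have hlen : L.length = J.length := by rw [← hLJ, List.length_map]
  have hss := ssum_le (fun p hp => (hL p hp).2)
  rw [hlen] at hss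
  -- points close to `x` have norm at least `r / 2`
  have hfar : ∀ y ∈ Metric.ball x0 δ, ∀ z, ‖z - y‖ ≤ ssum L → r / 2 < ‖z‖ := by
    intro y hy z hz
    rw [Metric.mem_ball, dist_eq_norm] at hy
    have h1 : x0 = z - ((z - y) + (y - x0)) := by abel
    have h2 : r ≤ ‖z‖ + (‖z - y‖ + ‖y - x0‖) := by
      rw [hrdef]
      conv_lhs => rw [h1]
      exact (norm_sub_le _ _).trans (by gcongr; exact norm_add_le _ _)
    nlinarith
  have hN : Tendsto (fun k : ℕ => (k : ℝ) + 1) atTop atTop :=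
    tendsto_atTop_add_const_right _ _ tendsto_natCast_atTop_atTop
  set N : ℕ → ℝ := fun k => (k : ℝ) + 1 with hNdef
  have hNpos : ∀ k, 0 < N k := fun k => by simp only [hNdef]; positivity
  set m : ℕ → Fin n → ℤ := fun k i => ⌊x i * N k⌋ with hm
  have hy : Tendsto (fun k => (N k)⁻¹ • latt (m k)) atTop (𝓝 x) := by
    rw [tendsto_pi_nhds]
    intro i
    have hlow : Tendsto (fun k => x i - (N k)⁻¹) atTop (𝓝 (x i)) := by
      simpa using (hN.inv_tendsto_atTop).const_sub (x i)
    refine tendsto_of_tendsto_of_tendsto_of_le_of_le hlow tendsto_const_nhds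
      (fun k => ?_) (fun k => ?_)
    · have := Int.lt_floor_add_one (x i * N k)
      have hk := hNpos k
      simp only [Pi.smul_apply, latt, hm, smul_eq_mul]
      have e : x i - (N k)⁻¹ = (N k)⁻¹ * (x i * N k - 1) := by field_simp
      rw [e]
      apply mul_le_mul_of_nonneg_left _ (inv_pos.2 hk).le
      linarith
    · have := Int.floor_le (x i * N k)
      have hk := hNpos k
      simp only [Pi.smul_apply, latt, hm, smul_eq_mul]
      rw [inv_mul_le_iff₀ hk]
      linarith
  have hlim1 := (dl_cont isOpen_ne hfc L hL0 N hN _ x hy (fun z hz => by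
    have := hfar x hx z hz
    exact norm_pos_iff.1 (by linarith))).norm
  have hlim2 := (sprod_cont L hL0 N hN).const_mul (C * ((r / 2) ^ J.length)⁻¹)
  refine le_of_tendsto_of_tendsto hlim1 hlim2 ?_
  filter_upwards [hy.eventually (Metric.isOpen_ball.mem_nhds hx)] with k hk
  have hNk := hNpos k
  have hsum := rnd_sum_le hNk L hL0
  have hpt : ∀ q : Fin n → ℤ, ‖latt q - latt (m k)‖ ≤ ssum L * N k → r / 2 * N k < ‖latt q‖ := by
    intro q hq
    have := hfar _ hk ((N k)⁻¹ • latt q) (by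
      rw [← smul_sub, norm_smul, norm_inv, Real.norm_eq_abs, abs_of_pos hNk, inv_mul_le_iff₀ hNk]
      linarith)
    rw [norm_smul, norm_inv, Real.norm_eq_abs, abs_of_pos hNk, lt_inv_mul_iff₀ hNk] at this
    linarith
  have hss0 := ssum_nonneg hL0
  have h0 := hpt (m k) (by rw [sub_self, norm_zero]; positivity)
  have hsmall : ssum L ≤ r / 2 := by nlinarith
  rw [dl_scl hNk hfh hfσ _ _ (by nlinarith), sprod_scl]
  have hfst : (rnd (N k) L).map Prod.fst = J := by
    rw [← hLJ]; simp [rnd, Function.comp_def]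
  have hlen2 : (rnd (N k) L).length = J.length := by
    rw [← hlen]; simp [rnd]
  refine (dlZ_bound _ σ (m k) (C * ((r / 2 * N k) ^ J.length)⁻¹) fun q hq => ?_).trans
    (le_of_eq ?_)
  · rw [hfst]
    exact hb q _ (by positivity) (hpt q (hq.trans hsum)).le
  · rw [hlen2, mul_pow, mul_inv]; ring

end ExtSmooth

/-- Any continuous `0`-homogeneous extension to `ℝ^n ∖ {0}` of a toroidal symbol of order `0`
which is `0`-homogeneous on the lattice is in fact smooth on `ℝ^n ∖ {0}`. -/
theorem extension_is_smooth (n : ℕ) (hn : 1 ≤ n)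
    (σ : (Fin n → ℤ) → ℂ) (hσ : ToroidalSymbol 0 σ)
    (hhom : ∀ ℓ : Fin n → ℤ, ℓ ≠ 0 → ∀ r : ℕ, 0 < r → σ ((r : ℤ) • ℓ) = σ ℓ)
    (f : (Fin n → ℝ) → ℂ)
    (hfc : ContinuousOn f {ξ : Fin n → ℝ | ξ ≠ 0})
    (hfh : ∀ t : ℝ, 0 < t → ∀ ξ : Fin n → ℝ, ξ ≠ 0 → f (t • ξ) = f ξ)
    (hfσ : ∀ ℓ : Fin n → ℤ, ℓ ≠ 0 → f (latt ℓ) = σ ℓ) :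
    ContDiffOn ℝ (⊤ : ℕ∞) f {ξ : Fin n → ℝ | ξ ≠ 0} := by

  rw [contDiffOn_infty]
  intro k
  exact ExtSmooth.smooth_of_PP isOpen_ne k f hfc (ExtSmooth.base_PP hσ hfc hfh hfσ)
end

section
/- Let n ≥ 1 and m ∈ ℂ. Let σ : ℝ^n × ℤ^n → ℂ be such that: (i) σ(x+k, ℓ) = σ(x, ℓ) for all x ∈ ℝ^n, k ∈ ℤ^n, ℓ ∈ ℤ^n (periodicity in x); (ii) x ↦ σ(x, ℓ) is smooth for each ℓ; (iii) for all multi-indices α, β ∈ ℕ^n there is C > 0 with |∂_x^β Δ^α σ(x, ℓ)| ≤ C ⟨ℓ⟩^{Re m − |α|} for all (x, ℓ), where Δ^α acts in the variable ℓ; (iv) σ(x, rℓ) = r^m σ(x, ℓ) for all x ∈ ℝ^n, ℓ ∈ ℤ^n ∖ {0} and every positive integer r. Then there exists a unique continuous function σ̃ : ℝ^n × (ℝ^n ∖ {0}) → ℂ which is ℤ^n-periodic in the first variable, m-homogeneous in the second variable (σ̃(x, tξ) = t^m σ̃(x, ξ) for all t > 0), and coincides with σ on ℝ^n × (ℤ^n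 ∖ {0}); moreover this extension σ̃ is smooth on ℝ^n × (ℝ^n ∖ {0}). -/
open scoped BigOperators

/-- The partial derivative `∂_j` of a function on `ℝ^n`. -/
noncomputable def pderiv' {n : ℕ} (j : Fin n) (F : (Fin n → ℝ) → ℂ) : (Fin n → ℝ) → ℂ :=
  fun x => fderiv ℝ F x (Pi.single j 1)

/-- The iterated partial derivative `∂^β = ∂_1^{β_1} ⋯ ∂_n^{β_n}`. -/
noncomputable def pderivPow {n : ℕ} (β : Fin n → ℕ) (F : (Fin n → ℝ) → ℂ) :
    (Fin n → ℝ) → ℂ :=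
  (List.ofFn (fun j : Fin n => (pderiv' j)^[β j])).foldr (· ∘ ·) id F

/-! ### Iterated differences on additive groups -/

section Diff

variable {A : Type*} [AddCommGroup A]

/-- First difference with step `v`. -/
def dd (v : A) (F : A → ℂ) : A → ℂ := fun p => F (p + v) - F p

/-- Iterated differences along a list of steps. -/
def itd (L : List A) (F : A → ℂ) : A → ℂ := L.foldr dd F

theorem itd_nil (F : A → ℂ) : itd [] F = F := rfl

theorem itd_cons (v : A) (L : List A) (F : A → ℂ) (q : A) :
    itd (v :: L) F q = itd L F (q + v) - itd L F q := rfl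

theorem itd_append (L M : List A) (F : A → ℂ) : itd (L ++ M) F = itd L (itd M F) := by
  simp [itd, List.foldr_append]

theorem itd_perm {L M : List A} (h : L.Perm M) (F : A → ℂ) : itd L F = itd M F := by
  induction h with
  | nil => rfl
  | cons x _ ih => funext q; simp only [itd_cons, ih]
  | swap x y l =>
    funext q
    simp only [itd_cons]
    rw [add_right_comm q y x]
    ring
  | trans _ _ h1 h2 => exact h1.trans h2

theorem itd_congr (L : List A) (F G : A → ℂ) (q : A)
    (h : ∀ M : List A, M.Sublist L → F (q + M.sum) = G (q + M.sum)) :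
    itd L F q = itd L G q := by
  induction L generalizing q with
  | nil => simpa [itd_nil] using h [] (List.Sublist.refl _)
  | cons v L ih =>
    rw [itd_cons, itd_cons, ih (q + v), ih q]
    · intro M hM; exact h M (hM.trans (List.sublist_cons_self _ _))
    · intro M hM
      have := h (v :: M) (hM.cons_cons v)
      simpa [add_assoc] using this

theorem itd_tendsto {β γ : Type*} {l : Filter β} [TopologicalSpace A]
    (L : List γ) (v : β → γ → A) (v0 : γ → A)
    (F : β → A → ℂ) (G : A → ℂ) (q : β → A) (q0 : A)
    (h : ∀ M : List γ, M.Sublist L →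
      Filter.Tendsto (fun b => F b (q b + (M.map (v b)).sum)) l (nhds (G (q0 + (M.map v0).sum)))) :
    Filter.Tendsto (fun b => itd (L.map (v b)) (F b) (q b)) l (nhds (itd (L.map v0) G q0)) := by
  induction L generalizing q q0 with
  | nil => simpa [itd_nil] using h [] (List.Sublist.refl _)
  | cons c L ih =>
    simp only [List.map_cons, itd_cons]
    refine Filter.Tendsto.sub (ih _ _ ?_) (ih _ _ ?_)
    · intro M hM
      have := h (c :: M) (hM.cons_cons c)
      simpa [add_assoc] using this
    · intro M hM; exact h M (hM.trans (List.sublist_cons_self _ _))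

theorem itd_hom {B : Type*} [AddCommGroup B] (φ : A →+ B) (L : List A) (F : B → ℂ) (q : A) :
    itd (L.map φ) F (φ q) = itd L (fun a => F (φ a)) q := by
  induction L generalizing q with
  | nil => rfl
  | cons v L ih => simp only [List.map_cons, itd_cons, ← ih, map_add]

theorem itd_smul (L : List A) (c : ℂ) (F : A → ℂ) (q : A) :
    itd L (fun a => c * F a) q = c * itd L F q := by
  induction L generalizing q with
  | nil => rfl
  | cons v L ih => simp only [itd_cons, ih]; ring

end Diff

/-! ### A one-dimensional lemma -/

theorem one_dim_aux (f : ℝ → ℂ) (ε C : ℝ) (hC : 0 ≤ C)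
    (h2 : ∀ s h k : ℝ, 0 < h → 0 < k → |s| + (h + k) < ε →
      ‖(f (s + h + k) - f (s + h)) - (f (s + k) - f s)‖ ≤ C * (h * k))
    (N : ℕ) (h : ℝ) (hh : 0 < h) (hN : (N + 1) * h < ε) :
    ‖(f (N * h) - f 0) - N * (f h - f 0)‖ ≤ C * (N * h) ^ 2 := by
  induction N with
  | zero => simp
  | succ N ih =>
    have hN' : (N + 1 : ℝ) * h < ε := by push_cast at hN; nlinarith
    have ih := ih hN'
    rcases Nat.eq_zero_or_pos N with h0 | h0
    · subst h0; simp; positivity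
    have hNp : (0:ℝ) < N := by exact_mod_cast h0
    have := h2 0 (N * h) h (by positivity) hh (by push_cast at hN; simp; nlinarith)
    have e : (f ((N + 1 : ℕ) * h) - f 0) - ((N + 1 : ℕ) : ℂ) * (f h - f 0) =
      ((f (N * h) - f 0) - N * (f h - f 0)) +
      ((f (0 + N * h + h) - f (0 + N * h)) - (f (0 + h) - f 0)) := by
      have : ((N + 1 : ℕ) : ℝ) * h = 0 + N * h + h := by push_cast; ring
      rw [this]; simp only [zero_add]; push_cast; ring
    rw [e]
    refine (norm_add_le _ _).trans ((add_le_add ih this).trans ?_)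
    push_cast
    have : 0 ≤ C * h ^ 2 * N := by positivity
    have : 0 ≤ C * h ^ 2 := by positivity
    nlinarith

theorem one_dim_aux2 (f : ℝ → ℂ) (ε C : ℝ) (hC : 0 ≤ C)
    (hcont : ∀ s, |s| < ε → ContinuousAt f s)
    (h2 : ∀ s h k : ℝ, 0 < h → 0 < k → |s| + (h + k) < ε →
      ‖(f (s + h + k) - f (s + h)) - (f (s + k) - f s)‖ ≤ C * (h * k))
    (u v : ℝ) (hu : 0 < u) (hv : 0 < v) (hu' : u < ε) (hv' : v < ε) :
    ‖v * (f u - f 0) - u * (f v - f 0)‖ ≤ C * (u + v) * (u * v) := by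
  -- steps `u / N`
  have key : ∀ᶠ N : ℕ in Filter.atTop,
      ‖((⌊v / (u / N)⌋₊ * (u / N) : ℝ) : ℂ) * (f u - f 0)
        - u * (f (⌊v / (u / N)⌋₊ * (u / N)) - f 0)‖ ≤
        C * (u + ⌊v / (u / N)⌋₊ * (u / N)) * (u * (⌊v / (u / N)⌋₊ * (u / N))) := by
    have t1 : Filter.Tendsto (fun N : ℕ => (u + u / N : ℝ)) Filter.atTop (nhds (u + 0)) :=
      tendsto_const_nhds.add (tendsto_const_div_atTop_nhds_zero_nat u)
    have t2 : Filter.Tendsto (fun N : ℕ => (v + u / N : ℝ)) Filter.atTop (nhds (v + 0)) :=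
      tendsto_const_nhds.add (tendsto_const_div_atTop_nhds_zero_nat u)
    filter_upwards [t1.eventually_lt_const (by simpa using hu'),
      t2.eventually_lt_const (by simpa using hv'), Filter.eventually_gt_atTop 0] with N h1 h3 hN
    have hNp : (0:ℝ) < N := by exact_mod_cast hN
    set h := u / N with hh
    have hhp : 0 < h := by positivity
    have huN : u = N * h := by rw [hh]; field_simp
    set M := ⌊v / h⌋₊ with hM
    have hMv : M * h ≤ v := by
      have := Nat.floor_le (div_pos hv hhp).le
      rwa [← hM, le_div_iff₀ hhp] at this
    have a1 := one_dim_aux f ε C hC h2 N h hhp (by rw [add_mul, ← huN]; linarith)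
    have a2 := one_dim_aux f ε C hC h2 M h hhp (by rw [add_mul]; linarith)
    rw [← huN] at a1
    have e : ((M * h : ℝ) : ℂ) * (f u - f 0) - u * (f (M * h) - f 0) =
      ((M * h : ℝ) : ℂ) * ((f u - f 0) - N * (f h - f 0)) -
       u * ((f (M * h) - f 0) - M * (f h - f 0)) := by
      have : (u : ℂ) = N * h := by rw [huN]; push_cast; ring
      rw [this]; push_cast; ring
    rw [e]
    refine (norm_sub_le _ _).trans ?_
    rw [norm_mul, norm_mul, Complex.norm_real, Complex.norm_real, Real.norm_of_nonneg hu.le,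
      Real.norm_of_nonneg (by positivity)]
    have b1 := mul_le_mul_of_nonneg_left a1 (show 0 ≤ M * h by positivity)
    have b2 := mul_le_mul_of_nonneg_left a2 hu.le
    refine (add_le_add b1 b2).trans (le_of_eq ?_)
    ring
  have t0 : Filter.Tendsto (fun N : ℕ => (⌊v / (u / N)⌋₊ * (u / N) : ℝ)) Filter.atTop (nhds v) := by
    have a := (tendsto_nat_floor_mul_div_atTop (R := ℝ) (a := v / u) (by positivity)).comp
      tendsto_natCast_atTop_atTop
    have := a.const_mul u
    rw [mul_div_cancel₀ v hu.ne'] at this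
    refine this.congr fun N => ?_
    simp only [Function.comp]
    rw [show v / (u / N) = v / u * N by rw [div_div_eq_mul_div]; ring]
    ring
  have tf : Filter.Tendsto (fun N : ℕ => f (⌊v / (u / N)⌋₊ * (u / N))) Filter.atTop (nhds (f v)) :=
    (hcont v (by rw [abs_of_pos hv]; exact hv')).tendsto.comp t0
  refine le_of_tendsto_of_tendsto ?_ ?_ key
  · exact ((((Complex.continuous_ofReal.tendsto v).comp t0).mul_const _).sub
      ((tf.sub_const _).const_mul _)).norm
  · exact ((t0.const_add u).const_mul C).mul (t0.const_mul u)

theorem one_dim (f : ℝ → ℂ) (ε C : ℝ) (hε : 0 < ε) (hC : 0 ≤ C)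
    (hcont : ∀ s, |s| < ε → ContinuousAt f s)
    (h2 : ∀ s h k : ℝ, 0 < h → 0 < k → |s| + (h + k) < ε →
      ‖(f (s + h + k) - f (s + h)) - (f (s + k) - f s)‖ ≤ C * (h * k)) :
    DifferentiableAt ℝ f 0 := by
  set D : ℝ → ℂ := fun u => (f u - f 0) / u with hD
  have hDD : ∀ u v, 0 < u → 0 < v → u < ε → v < ε → ‖D u - D v‖ ≤ C * (u + v) := by
    intro u v hu hv hu' hv'
    have := one_dim_aux2 f ε C hC hcont h2 u v hu hv hu' hv'
    have hu0 : (u : ℂ) ≠ 0 := by exact_mod_cast hu.ne'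
    have hv0 : (v : ℂ) ≠ 0 := by exact_mod_cast hv.ne'
    have e : D u - D v = (v * (f u - f 0) - u * (f v - f 0)) / ((u * v : ℝ) : ℂ) := by
      simp only [hD]; push_cast; field_simp
    rw [e, norm_div, Complex.norm_real, Real.norm_of_nonneg (by positivity),
      div_le_iff₀ (by positivity)]
    exact this
  obtain ⟨g, hg⟩ : ∃ g, Filter.Tendsto D (nhdsWithin 0 (Set.Ioi 0)) (nhds g) := by
    apply cauchy_map_iff_exists_tendsto.1
    rw [Metric.cauchy_iff]
    refine ⟨inferInstance, fun η hη => ?_⟩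
    obtain ⟨δ, hδ, hδε, hδη⟩ : ∃ δ > 0, δ < ε ∧ C * (δ + δ) < η := by
      refine ⟨min (ε / 2) (η / (4 * (C + 1))), by positivity, ?_, ?_⟩
      · exact (min_le_left _ _).trans_lt (by linarith)
      · have h1 : min (ε / 2) (η / (4 * (C + 1))) ≤ η / (4 * (C + 1)) := min_le_right _ _
        have h2 : C * (η / (4 * (C + 1)) + η / (4 * (C + 1))) ≤ η / 2 := by
          rw [← add_div, ← mul_div_assoc, div_le_iff₀ (by positivity)]; nlinarith
        have := mul_le_mul_of_nonneg_left (add_le_add h1 h1) hC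
        linarith
    refine ⟨D '' Set.Ioo 0 δ, Filter.image_mem_map (Ioo_mem_nhdsGT hδ), ?_⟩
    rintro _ ⟨u, hu, rfl⟩ _ ⟨v, hv, rfl⟩
    rw [dist_eq_norm]
    refine (hDD u v hu.1 hv.1 (hu.2.trans hδε) (hv.2.trans hδε)).trans_lt (lt_of_le_of_lt ?_ hδη)
    exact mul_le_mul_of_nonneg_left (add_le_add hu.2.le hv.2.le) hC
  have hgD : ∀ u, 0 < u → u < ε → ‖D u - g‖ ≤ C * u := by
    intro u hu hu'
    have t : Filter.Tendsto (fun v : ℝ => C * (u + v)) (nhdsWithin 0 (Set.Ioi 0))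
        (nhds (C * (u + 0))) :=
      ((tendsto_nhdsWithin_of_tendsto_nhds (Filter.tendsto_id.const_add u)).const_mul C)
    rw [add_zero] at t
    refine le_of_tendsto_of_tendsto (hg.const_sub (D u)).norm t ?_
    filter_upwards [Ioo_mem_nhdsGT hε] with v hv
    exact hDD u v hu hv.1 hu' hv.2
  have hpos : ∀ u, 0 < u → u < ε → ‖f u - f 0 - u * g‖ ≤ C * u ^ 2 := by
    intro u hu hu'
    have hu0 : (u : ℂ) ≠ 0 := by exact_mod_cast hu.ne'
    have e : f u - f 0 - u * g = u * (D u - g) := by simp only [hD]; field_simp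
    rw [e, norm_mul, Complex.norm_real, Real.norm_of_nonneg hu.le]
    have := mul_le_mul_of_nonneg_left (hgD u hu hu') hu.le
    linarith [this]
  have hall : ∀ u, |u| < ε / 3 → ‖f u - f 0 - u * g‖ ≤ 2 * C * u ^ 2 := by
    intro u hu
    rcases lt_trichotomy u 0 with h | h | h
    · rw [abs_of_neg h] at hu
      have a := hpos (-u) (by linarith) (by linarith)
      have b := h2 u (-u) (-u) (by linarith) (by linarith) (by rw [abs_of_neg h]; linarith)
      have e : f u - f 0 - u * g = ((f (u + -u + -u) - f (u + -u)) - (f (u + -u) - f u))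
          - (f (-u) - f 0 - ((-u : ℝ) : ℂ) * g) := by
        simp only [add_neg_cancel, zero_add]; push_cast; ring
      rw [e]
      refine (norm_sub_le _ _).trans ((add_le_add b a).trans (le_of_eq ?_))
      ring
    · subst h; simp
    · rw [abs_of_pos h] at hu
      refine (hpos u h (by linarith)).trans ?_
      have : 0 ≤ C * u ^ 2 := by positivity
      linarith
  have : HasDerivAt f g 0 := by
    rw [hasDerivAt_iff_isLittleO]
    refine Asymptotics.IsBigO.trans_isLittleO (g := fun u : ℝ => (u - 0) ^ 2) ?_ ?_
    · refine Asymptotics.IsBigO.of_bound (2 * C) ?_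
      have : ∀ᶠ u : ℝ in nhds 0, |u| < ε / 3 := by
        have := Metric.ball_mem_nhds (0:ℝ) (show 0 < ε / 3 by positivity)
        filter_upwards [this] with u hu
        simpa using hu
      filter_upwards [this] with u hu
      have := hall u hu
      simpa [Complex.real_smul] using this
    · simpa using (Asymptotics.isLittleO_pow_id (𝕜 := ℝ) (n := 2) (by norm_num))
  exact this.differentiableAt
/-! ### Smoothness from bounds on iterated differences -/

section Smooth

set_option linter.unusedSectionVars false

variable {ι : Type*} [Fintype ι] [DecidableEq ι]

theorem coord_lipschitz (f : (ι → ℝ) → ℂ) (S : Set ℝ) (p : ι → ℝ) (δ C : ℝ)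
    (h : ∀ q : ι → ℝ, (∀ i, q i ∈ S) → dist q p < δ → ∀ i, ∀ s : ℝ, 0 < s → q i + s ∈ S →
      |q i + s - p i| < δ → ‖f (q + Pi.single i s) - f q‖ ≤ C * s)
    (q q' : ι → ℝ) (hq : ∀ i, q i ∈ S) (hq' : ∀ i, q' i ∈ S) (hd : dist q p < δ)
    (hd' : dist q' p < δ) : ‖f q' - f q‖ ≤ C * ∑ i, |q' i - q i| := by
  have hδ : 0 < δ := dist_nonneg.trans_lt hd
  have upd : ∀ q : ι → ℝ, (∀ i, q i ∈ S) → dist q p < δ → ∀ i, ∀ t ∈ S, |t - p i| < δ →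
      ‖f (Function.update q i t) - f q‖ ≤ C * |t - q i| := by
    intro q hq hd i t ht htp
    have e1 : ∀ (q : ι → ℝ) (t : ℝ), Function.update q i t = q + Pi.single i (t - q i) := by
      intro q t
      ext j
      rcases eq_or_ne j i with rfl | hj
      · simp
      · simp [hj]
    rcases lt_trichotomy (t - q i) 0 with h0 | h0 | h0
    · set q2 := Function.update q i t with hq2
      have e2 : q = q2 + Pi.single i (q i - t) := by
        have := e1 q2 (q i)
        simpa [hq2] using this
      have hqi : |q i - p i| < δ := by
        have := (dist_pi_lt_iff hδ).1 hd i
        rwa [Real.dist_eq] at this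
      have := h q2 ?_ ?_ i (q i - t) (by linarith) (by simp [hq2, hq i]) (by simpa [hq2] using hqi)
      · rw [← e2, norm_sub_rev] at this
        rwa [abs_of_neg h0, neg_sub]
      · intro j
        rcases eq_or_ne j i with rfl | hj
        · simpa [hq2] using ht
        · simpa [hq2, hj] using hq j
      · rw [dist_pi_lt_iff hδ] at hd ⊢
        intro j
        rcases eq_or_ne j i with rfl | hj
        · simpa [hq2, Real.dist_eq] using htp
        · simpa [hq2, hj] using hd j
    · rw [h0]; rw [e1, h0]; simp
    · rw [e1, abs_of_pos h0]
      exact h q hq hd i (t - q i) h0 (by simpa using ht) (by simpa using htp)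
  have main : ∀ s : Finset ι, ‖f (s.piecewise q' q) - f q‖ ≤ C * ∑ i ∈ s, |q' i - q i| := by
    intro s
    induction s using Finset.induction_on with
    | empty => simp
    | insert a s ha ih =>
      rw [Finset.piecewise_insert, Finset.sum_insert ha]
      have h1 := upd (s.piecewise q' q) ?_ ?_ a (q' a) (hq' a) ?_
      · have e : (s.piecewise q' q) a = q a := Finset.piecewise_eq_of_notMem _ _ _ ha
        rw [e] at h1
        calc _ ≤ _ := norm_sub_le_norm_sub_add_norm_sub _ (f (s.piecewise q' q)) _
          _ ≤ _ := add_le_add h1 ih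
          _ = _ := by ring
      · intro i
        by_cases hi : i ∈ s <;> simp [hi, hq, hq']
      · rw [dist_pi_lt_iff hδ] at hd hd' ⊢
        intro i
        by_cases hi : i ∈ s
        · simpa [hi] using hd' i
        · simpa [hi] using hd i
      · have := (dist_pi_lt_iff hδ).1 hd' a
        rwa [Real.dist_eq] at this
  simpa using main Finset.univ

/-- All iterated difference quotients are locally bounded. -/
def Good (U : Set (ι → ℝ)) (F : (ι → ℝ) → ℂ) : Prop :=
  ∀ p ∈ U, ∃ ε > 0, ∀ w : List ι, ∃ C : ℝ, 0 ≤ C ∧ ∀ L : List (ι × ℝ), L.map Prod.fst = w →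
    (∀ a ∈ L, 0 < a.2) → ∀ q, dist q p + (L.map Prod.snd).sum < ε →
      ‖itd (L.map fun a => (Pi.single a.1 a.2 : ι → ℝ)) F q‖ ≤ C * (L.map Prod.snd).prod

theorem sum_abs_le_card (q p : ι → ℝ) : ∑ i, |q i - p i| ≤ Fintype.card ι * dist q p := by
  calc ∑ i, |q i - p i| ≤ ∑ _i : ι, dist q p :=
        Finset.sum_le_sum fun i _ => by rw [← Real.dist_eq]; exact dist_le_pi_dist q p i
    _ = _ := by simp

theorem Good.continuousAt {U : Set (ι → ℝ)} {F : (ι → ℝ) → ℂ} (hF : Good U F) (p : ι → ℝ)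
    (hp : p ∈ U) : ContinuousAt F p := by
  obtain ⟨ε, hε, H⟩ := hF p hp
  choose C hC0 hC using fun i : ι => H [i]
  have hsum : ∀ i, C i ≤ ∑ j, C j := fun i =>
    Finset.single_le_sum (fun j _ => hC0 j) (Finset.mem_univ i)
  have lip := coord_lipschitz F Set.univ p (ε / 3) (∑ j, C j) (by
    intro q _ hq i s hs _ hqs
    have hqi : |q i - p i| < ε / 3 := by
      rw [← Real.dist_eq]; exact (dist_le_pi_dist q p i).trans_lt hq
    have := hC i [(i, s)] rfl (by simpa using hs) q (by
      simp only [List.map_cons, List.map_nil, List.sum_cons, List.sum_nil]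
      rw [abs_lt] at hqi hqs
      linarith)
    simp only [List.map_cons, List.map_nil, itd_cons, itd_nil, List.prod_cons, List.prod_nil,
      mul_one] at this
    exact this.trans (mul_le_mul_of_nonneg_right (hsum i) hs.le))
  have hCs : 0 ≤ ∑ j, C j := Finset.sum_nonneg fun j _ => hC0 j
  rw [Metric.continuousAt_iff]
  intro η hη
  refine ⟨min (ε / 3) (η / ((∑ j, C j) * Fintype.card ι + 1)), by positivity, fun {q} hq => ?_⟩
  have h1 := hq.trans_le (min_le_left _ _)
  have h2 := hq.trans_le (min_le_right _ _)
  have := lip p q (by simp) (by simp) (by simpa using hε) h1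
  rw [dist_eq_norm]
  refine this.trans_lt ?_
  have h3 := mul_le_mul_of_nonneg_left (sum_abs_le_card q p) hCs
  rw [lt_div_iff₀ (by positivity)] at h2
  have : 0 ≤ dist q p := dist_nonneg
  nlinarith

theorem norm_list_sum_single (M : List (ι × ℝ)) (hM : ∀ a ∈ M, 0 ≤ a.2) :
    ‖(M.map fun a => (Pi.single a.1 a.2 : ι → ℝ)).sum‖ ≤ (M.map Prod.snd).sum := by
  induction M with
  | nil => simp
  | cons a M ih =>
    simp only [List.map_cons, List.sum_cons]
    refine (norm_add_le _ _).trans (add_le_add ?_ (ih fun b hb => hM b (by simp [hb])))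
    rw [Pi.norm_single, Real.norm_of_nonneg (hM a (by simp))]

theorem sublist_sum_le (M L : List (ι × ℝ)) (h : M.Sublist L) (hL : ∀ a ∈ L, 0 ≤ a.2) :
    (M.map Prod.snd).sum ≤ (L.map Prod.snd).sum := by
  refine (h.map Prod.snd).sum_le_sum ?_
  intro a ha
  obtain ⟨b, hb, rfl⟩ := List.mem_map.1 ha
  exact hL b hb

theorem region_mem (M L : List (ι × ℝ)) (h : M.Sublist L) (hL : ∀ a ∈ L, 0 ≤ a.2)
    (p q : ι → ℝ) (ε : ℝ) (hq : dist q p + (L.map Prod.snd).sum < ε) :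
    dist (q + (M.map fun a => (Pi.single a.1 a.2 : ι → ℝ)).sum) p < ε := by
  have h1 := norm_list_sum_single M fun a ha => hL a (h.subset ha)
  have h2 := sublist_sum_le M L h hL
  have h3 := dist_triangle (q + (M.map fun a => (Pi.single a.1 a.2 : ι → ℝ)).sum) q p
  rw [dist_self_add_left] at h3
  linarith

theorem Good.deriv {U : Set (ι → ℝ)} (hU : IsOpen U) {F : (ι → ℝ) → ℂ} (hF : Good U F) (i : ι) :
    ∃ G : (ι → ℝ) → ℂ, Good U G ∧
      ∀ p ∈ U, HasDerivAt (fun t : ℝ => F (p + Pi.single i t)) (G p) 0 := by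
  have hd : ∀ p ∈ U, DifferentiableAt ℝ (fun t : ℝ => F (p + Pi.single i t)) 0 := by
    intro p hp
    obtain ⟨ε, hε, H⟩ := hF p hp
    obtain ⟨C, hC0, hC⟩ := H [i, i]
    obtain ⟨ε', hε', hball⟩ := Metric.isOpen_iff.1 hU p hp
    refine one_dim _ (min ε ε') C (by positivity) hC0 ?_ ?_
    · intro s hs
      have h1 : p + Pi.single i s ∈ U := by
        apply hball
        rw [Metric.mem_ball, dist_self_add_left, Pi.norm_single, Real.norm_eq_abs]
        exact hs.trans_le (min_le_right _ _)
      have := hF.continuousAt _ h1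
      have h3 : ContinuousAt (fun t : ℝ => p + (Pi.single i t : ι → ℝ)) s := by
        have : Continuous (fun t : ℝ => (Pi.single i t : ι → ℝ)) :=
          continuous_single (A := fun _ : ι => ℝ) i
        exact (continuous_const.add this).continuousAt
      exact ContinuousAt.comp (f := fun t : ℝ => p + (Pi.single i t : ι → ℝ)) this h3
    · intro s h k hh hk hs
      have := hC [(i, h), (i, k)] rfl (by simp [hh, hk]) (p + Pi.single i s) (by
        simp only [List.map_cons, List.map_nil, List.sum_cons, List.sum_nil]
        rw [dist_self_add_left, Pi.norm_single, Real.norm_eq_abs]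
        have := hs.trans_le (min_le_left _ _)
        linarith)
      simpa [itd_cons, itd_nil, add_assoc, ← Pi.single_add] using this
  refine ⟨fun p => _root_.deriv (fun t : ℝ => F (p + Pi.single i t)) 0, ?_,
    fun p hp => (hd p hp).hasDerivAt⟩
  intro p hp
  obtain ⟨ε, hε, H⟩ := hF p hp
  obtain ⟨ε', hε', hball⟩ := Metric.isOpen_iff.1 hU p hp
  refine ⟨min ε ε', by positivity, fun w => ?_⟩
  obtain ⟨C, hC0, hC⟩ := H (i :: w)
  refine ⟨C, hC0, fun L hL hpos q hq => ?_⟩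
  have hq1 := hq.trans_le (min_le_left _ _)
  have hq2 := hq.trans_le (min_le_right _ _)
  have T := itd_tendsto (l := nhdsWithin (0:ℝ) (Set.Ioi 0)) L
    (fun _ a => (Pi.single a.1 a.2 : ι → ℝ)) (fun a => (Pi.single a.1 a.2 : ι → ℝ))
    (fun h q => ((h⁻¹ : ℝ) : ℂ) * dd (Pi.single i h : ι → ℝ) F q)
    (fun p => _root_.deriv (fun t : ℝ => F (p + Pi.single i t)) 0) (fun _ => q) q (by
      intro M hM
      have hm : q + (M.map fun a => (Pi.single a.1 a.2 : ι → ℝ)).sum ∈ U :=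
        hball (region_mem M L hM (fun a ha => (hpos a ha).le) p q ε' hq2)
      have := (hd _ hm).hasDerivAt.tendsto_slope_zero_right
      refine this.congr fun h => ?_
      simp [dd, Complex.real_smul])
  refine le_of_tendsto T.norm ?_
  filter_upwards [Ioo_mem_nhdsGT (show 0 < ε - (dist q p + (L.map Prod.snd).sum) by linarith)]
    with h hh
  have b := hC ((i, h) :: L) (by simp [hL]) (by
    intro a ha
    rcases List.mem_cons.1 ha with rfl | ha
    · exact hh.1
    · exact hpos a ha) q (by simp only [List.map_cons, List.sum_cons]; linarith [hh.2])
  rw [itd_smul, norm_mul, Complex.norm_real, Real.norm_of_nonneg (inv_pos.2 hh.1).le]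
  have e : itd (L.map fun a => (Pi.single a.1 a.2 : ι → ℝ)) (dd (Pi.single i h) F) =
      itd (((i, h) :: L).map fun a => (Pi.single a.1 a.2 : ι → ℝ)) F := by
    rw [List.map_cons, ← itd_perm (List.perm_append_singleton _ _), itd_append]; rfl
  rw [e]
  have := mul_le_mul_of_nonneg_left b (inv_pos.2 hh.1).le
  refine this.trans (le_of_eq ?_)
  have := hh.1.ne'
  simp only [List.map_cons, List.prod_cons]
  field_simp

theorem hasFDerivAt_of_partials {U : Set (ι → ℝ)} (hU : IsOpen U) (F : (ι → ℝ) → ℂ)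
    (G : ι → (ι → ℝ) → ℂ) (hG : ∀ i, ∀ p ∈ U, ContinuousAt (G i) p)
    (hd : ∀ i, ∀ p ∈ U, HasDerivAt (fun t : ℝ => F (p + Pi.single i t)) (G i p) 0)
    (p : ι → ℝ) (hp : p ∈ U) :
    HasFDerivAt F (∑ i, (ContinuousLinearMap.proj (R := ℝ) (φ := fun _ : ι => ℝ) i).smulRight
      (G i p)) p := by
  set Λ := ∑ i, (ContinuousLinearMap.proj (R := ℝ) (φ := fun _ : ι => ℝ) i).smulRight (G i p)
    with hΛ
  have hΛs : ∀ i t, Λ (Pi.single i t) = t * G i p := by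
    intro i t
    simp only [hΛ, _root_.sum_apply, ContinuousLinearMap.smulRight_apply,
      ContinuousLinearMap.proj_apply, Complex.real_smul]
    rw [Finset.sum_eq_single i]
    · simp
    · intro j _ hj; simp [hj]
    · simp
  rw [hasFDerivAt_iff_isLittleO, Asymptotics.isLittleO_iff]
  intro c hc
  set η := c / (Fintype.card ι + 1) with hη
  have hηp : 0 < η := by positivity
  have ev : ∀ᶠ q in nhds p, q ∈ U ∧ ∀ i, ‖G i q - G i p‖ < η := by
    refine Filter.Eventually.and (hU.mem_nhds hp) (Filter.eventually_all.2 fun i => ?_)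
    have := (hG i p hp).tendsto.eventually (Metric.ball_mem_nhds (G i p) hηp)
    simpa [dist_eq_norm] using this
  obtain ⟨δ, hδ, hb⟩ := Metric.eventually_nhds_iff.1 ev
  have lip := coord_lipschitz (fun q => F q - Λ q) Set.univ p δ η (by
    intro q _ hq i s hs _ hqs
    have hq' := (dist_pi_lt_iff hδ).1 hq
    have hin : ∀ t ∈ Set.Icc 0 s, dist (q + Pi.single i t) p < δ := by
      intro t ht
      rw [dist_pi_lt_iff hδ]
      intro j
      rcases eq_or_ne j i with rfl | hj
      · have := hq' j
        rw [Real.dist_eq, abs_lt] at this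
        rw [Real.dist_eq, abs_lt]
        rw [abs_lt] at hqs
        simp only [Pi.add_apply, Pi.single_eq_same]
        constructor <;> linarith [ht.1, ht.2]
      · simpa [hj] using hq' j
    have hder : ∀ t ∈ Set.Icc 0 s, HasDerivWithinAt
        (fun t : ℝ => F (q + Pi.single i t) - Λ (q + Pi.single i t))
        (G i (q + Pi.single i t) - G i p) (Set.Icc 0 s) t := by
      intro t ht
      have h1 := hd i _ (hb (hin t ht)).1
      have h2 : HasDerivAt (fun t' : ℝ => F (q + Pi.single i t')) (G i (q + Pi.single i t)) t := by
        have h3 : HasDerivAt (fun u : ℝ => F (q + Pi.single i t + Pi.single i u))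
          (G i (q + Pi.single i t)) (t - t) := by simpa using h1
        have := h3.comp_sub_const t t
        refine this.congr_of_eventuallyEq (Filter.Eventually.of_forall fun u => ?_)
        simp [add_assoc, ← Pi.single_add]
      have h4 : HasDerivAt (fun t : ℝ => Λ (q + Pi.single i t)) (G i p) t := by
        simp only [map_add, hΛs]
        have := ((hasDerivAt_id t).ofReal_comp.mul_const (G i p)).const_add (Λ q)
        simpa using this
      exact (h2.sub h4).hasDerivWithinAt
    have := (convex_Icc 0 s).norm_image_sub_le_of_norm_hasDerivWithin_le hder
      (fun t ht => ((hb (hin t ht)).2 i).le) (Set.left_mem_Icc.2 hs.le) (Set.right_mem_Icc.2 hs.le)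
    simpa [abs_of_pos hs] using this)
  have : ∀ᶠ q in nhds p, dist q p < δ := Metric.ball_mem_nhds p hδ
  filter_upwards [this] with q hq
  have := lip p q (by simp) (by simp) (by simpa using hδ) hq
  have e : F q - F p - Λ (q - p) = F q - Λ q - (F p - Λ p) := by rw [map_sub]; ring
  rw [e]
  refine this.trans ((mul_le_mul_of_nonneg_left (sum_abs_le_card q p) hηp.le).trans ?_)
  rw [dist_eq_norm, ← mul_assoc]
  refine mul_le_mul_of_nonneg_right ?_ (norm_nonneg _)
  rw [hη, div_mul_eq_mul_div, div_le_iff₀ (by positivity)]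
  nlinarith

theorem Good.contDiffOn {U : Set (ι → ℝ)} (hU : IsOpen U) (k : ℕ) {F : (ι → ℝ) → ℂ}
    (hF : Good U F) : ContDiffOn ℝ k F U := by
  induction k generalizing F with
  | zero =>
    rw [Nat.cast_zero, contDiffOn_zero]
    exact fun p hp => (hF.continuousAt p hp).continuousWithinAt
  | succ k ih =>
    choose G hG hd using fun i => hF.deriv hU i
    have hfd := hasFDerivAt_of_partials hU F G (fun i p hp => (hG i).continuousAt p hp) hd
    rw [Nat.cast_succ, contDiffOn_succ_iff_fderiv_of_isOpen hU]
    refine ⟨fun p hp => (hfd p hp).differentiableAt.differentiableWithinAt, by simp, ?_⟩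
    have : ContDiffOn ℝ k (fun p => ∑ i,
        (ContinuousLinearMap.proj (R := ℝ) (φ := fun _ : ι => ℝ) i).smulRight (G i p)) U := by
      refine ContDiffOn.sum fun i _ => ?_
      exact contDiffOn_const.smulRight (ih (hG i))
    exact this.congr fun p hp => (hfd p hp).fderiv

end Smooth
/-! ### Sorted words, and the unit-step estimate -/

section Words

variable {n : ℕ}

/-- The sorted word with prescribed multiplicities. -/
def sw (α : Fin n → ℕ) : List (Fin n) :=
  (List.finRange n).flatMap fun j => List.replicate (α j) j

theorem foldr_replicate_iterate {X ι : Type*} (T : ι → X → X) (j : ι) (k : ℕ) (x : X) :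
    (List.replicate k j).foldr T x = (T j)^[k] x := by
  induction k with
  | zero => rfl
  | succ k ih => rw [List.replicate_succ, List.foldr_cons, ih, Function.iterate_succ_apply']

theorem foldr_ofFn_sw {X : Type*} (T : Fin n → X → X) (α : Fin n → ℕ) (x : X) :
    (List.ofFn (fun j : Fin n => (T j)^[α j])).foldr (· ∘ ·) id x = (sw α).foldr T x := by
  rw [List.ofFn_eq_map, sw]
  generalize List.finRange n = l
  induction l with
  | nil => rfl
  | cons j l ih =>
    simp only [List.map_cons, List.foldr_cons, List.flatMap_cons, List.foldr_append,
      Function.comp_apply, ← ih, foldr_replicate_iterate]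

theorem DeltaPow_eq (α : Fin n → ℕ) (g : (Fin n → ℤ) → ℂ) :
    DeltaPow α g = itd ((sw α).map fun j => (Pi.single j 1 : Fin n → ℤ)) g := by
  unfold DeltaPow
  rw [foldr_ofFn_sw, itd, List.foldr_map]
  rfl

theorem pderivPow_eq (α : Fin n → ℕ) (g : (Fin n → ℝ) → ℂ) :
    pderivPow α g = (sw α).foldr pderiv' g := by
  unfold pderivPow
  rw [foldr_ofFn_sw]

theorem count_sw (α : Fin n → ℕ) (i : Fin n) : (sw α).count i = α i := by
  rw [sw, List.count_flatMap, ← List.ofFn_eq_map, List.sum_ofFn]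
  simp [List.count_replicate]

theorem length_sw (α : Fin n → ℕ) : (sw α).length = ∑ j, α j := by
  rw [sw, List.length_flatMap, ← List.ofFn_eq_map, List.sum_ofFn]
  simp

instance lawfulBEq_sum_fin : LawfulBEq (Fin n ⊕ Fin n) where
  eq_of_beq := by
    rintro (a | a) (b | b) h
    · exact congrArg _ (eq_of_beq (α := Fin n) h)
    · exact nomatch h
    · exact nomatch h
    · exact congrArg _ (eq_of_beq (α := Fin n) h)
  rfl := by
    rintro (a | a)
    · exact beq_self_eq_true a
    · exact beq_self_eq_true a

theorem perm_sw (w : List (Fin n ⊕ Fin n)) :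
    w.Perm ((sw fun j => w.count (Sum.inl j)).map Sum.inl ++
      (sw fun j => w.count (Sum.inr j)).map Sum.inr) := by
  rw [List.perm_iff_count]
  rintro (i | i)
  · rw [List.count_append, List.count_map_of_injective _ _ Sum.inl_injective, count_sw,
      List.count_eq_zero.2 (show Sum.inl i ∉ List.map Sum.inr _ by simp), add_zero]
  · rw [List.count_append, List.count_map_of_injective _ _ Sum.inr_injective, count_sw,
      List.count_eq_zero.2 (show Sum.inr i ∉ List.map Sum.inl _ by simp), zero_add]

theorem itd_hasDerivAt (L : List (Fin n → ℝ)) (f : (Fin n → ℝ) → ℂ) (hf : Differentiable ℝ f)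
    (i : Fin n) (x : Fin n → ℝ) (t : ℝ) :
    HasDerivAt (fun t : ℝ => itd L f (x + Pi.single i t))
      (itd L (pderiv' i f) (x + Pi.single i t)) t := by
  induction L generalizing x with
  | nil =>
    simp only [itd_nil, pderiv']
    have h1 : HasDerivAt (fun t : ℝ => x + (Pi.single i t : Fin n → ℝ)) (Pi.single i 1) t := by
      have h2 : HasDerivAt (fun t : ℝ => x + t • (Pi.single i 1 : Fin n → ℝ))
          ((1:ℝ) • (Pi.single i 1 : Fin n → ℝ)) t :=
        ((hasDerivAt_id t).smul_const (Pi.single i 1 : Fin n → ℝ)).const_add x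
      rw [one_smul] at h2
      refine h2.congr_of_eventuallyEq (Filter.Eventually.of_forall fun s => ?_)
      simp [← Pi.single_smul]
    exact (hf _).hasFDerivAt.comp_hasDerivAt t h1
  | cons v L ih =>
    simp only [itd_cons]
    have a := ih (x + v)
    simp only [add_right_comm x v] at a
    exact a.sub (ih x)

theorem pderiv_contDiff (f : (Fin n → ℝ) → ℂ) (hf : ContDiff ℝ (⊤ : ℕ∞) f) (i : Fin n) :
    ContDiff ℝ (⊤ : ℕ∞) (pderiv' i f) := by
  unfold pderiv'
  exact (hf.fderiv_right (m := ((⊤ : ℕ∞) : WithTop ℕ∞)) (by simp)).clm_apply contDiff_const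

theorem mvt_itd (w : List (Fin n)) (f : (Fin n → ℝ) → ℂ) (hf : ContDiff ℝ (⊤ : ℕ∞) f)
    (h : ℝ) (hh : 0 < h) (M : ℝ) (hM : ∀ x, ‖w.foldr pderiv' f x‖ ≤ M) (x : Fin n → ℝ) :
    ‖itd (w.map fun i => (Pi.single i h : Fin n → ℝ)) f x‖ ≤ M * h ^ w.length := by
  induction w using List.reverseRecOn generalizing f x with
  | nil => simpa [itd_nil] using hM x
  | append_singleton w i ih =>
    have ih' := ih (pderiv' i f) (pderiv_contDiff f hf i) (by simpa using hM)
    rw [List.map_append, List.map_singleton, itd_perm (List.perm_append_singleton _ _), itd_cons]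
    have hder := fun t => (itd_hasDerivAt (w.map fun i => (Pi.single i h : Fin n → ℝ)) f
      (hf.differentiable (by simp)) i x t).hasDerivWithinAt (s := Set.univ)
    have := convex_univ.norm_image_sub_le_of_norm_hasDerivWithin_le (fun t _ => hder t)
      (fun t _ => ih' _) (Set.mem_univ 0) (Set.mem_univ h)
    simp only [Pi.single_zero, add_zero, sub_zero, Real.norm_of_nonneg hh.le] at this
    refine this.trans (le_of_eq ?_)
    rw [List.length_append, List.length_singleton, pow_succ]
    ring

/-- The rescaled symbol on the lattice. -/
noncomputable def Sg (m : ℂ) (σ : (Fin n → ℝ) → (Fin n → ℤ) → ℂ) (r : ℕ)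
    (k : Fin n ⊕ Fin n → ℤ) : ℂ :=
  (r : ℂ) ^ (-m) * σ (fun i => (k (Sum.inl i) : ℝ) / r) (fun j => k (Sum.inr j))

theorem itd_inr (l : List (Fin n)) (g : (Fin n → ℤ) → (Fin n → ℤ) → ℂ)
    (k : Fin n ⊕ Fin n → ℤ) :
    itd ((l.map Sum.inr).map fun i => (Pi.single i 1 : Fin n ⊕ Fin n → ℤ))
      (fun k => g (fun i => k (Sum.inl i)) (fun i => k (Sum.inr i))) k =
    itd (l.map fun i => (Pi.single i 1 : Fin n → ℤ)) (g (fun i => k (Sum.inl i)))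
      (fun i => k (Sum.inr i)) := by
  induction l generalizing k with
  | nil => rfl
  | cons a l ih =>
    simp only [List.map_cons, itd_cons, ih]
    have e1 : (fun i => (k + (Pi.single (Sum.inr a) 1 : Fin n ⊕ Fin n → ℤ)) (Sum.inl i)) =
      fun i => k (Sum.inl i) := by ext i; simp
    have e2 : (fun i => (k + (Pi.single (Sum.inr a) 1 : Fin n ⊕ Fin n → ℤ)) (Sum.inr i)) =
      (fun i => k (Sum.inr i)) + Pi.single a 1 := by
      ext i
      rcases eq_or_ne i a with rfl | h <;> simp [*]
    rw [e1, e2]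

theorem itd_inl (l : List (Fin n)) (r : ℕ) (g : (Fin n → ℝ) → (Fin n → ℤ) → ℂ)
    (k : Fin n ⊕ Fin n → ℤ) :
    itd ((l.map Sum.inl).map fun i => (Pi.single i 1 : Fin n ⊕ Fin n → ℤ))
      (fun k => g (fun i => (k (Sum.inl i) : ℝ) / r) (fun i => k (Sum.inr i))) k =
    itd (l.map fun i => (Pi.single i (1 / r : ℝ) : Fin n → ℝ))
      (fun y => g y (fun i => k (Sum.inr i))) (fun i => (k (Sum.inl i) : ℝ) / r) := by
  induction l generalizing k with
  | nil => rfl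
  | cons a l ih =>
    simp only [List.map_cons, itd_cons, ih]
    have e1 : (fun i => (k + (Pi.single (Sum.inl a) 1 : Fin n ⊕ Fin n → ℤ)) (Sum.inr i)) =
      fun i => k (Sum.inr i) := by ext i; simp
    have e2 : (fun i => (((k + (Pi.single (Sum.inl a) 1 : Fin n ⊕ Fin n → ℤ)) (Sum.inl i) : ℤ) : ℝ)
        / r) = (fun i => (k (Sum.inl i) : ℝ) / r) + Pi.single a (1 / r : ℝ) := by
      ext i
      rcases eq_or_ne i a with rfl | h
      · simp [add_div]
      · simp [h]
    rw [e1, e2]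

theorem itd_contDiff (L : List (Fin n → ℤ)) (σ : (Fin n → ℝ) → (Fin n → ℤ) → ℂ)
    (hsm : ∀ ℓ : Fin n → ℤ, ContDiff ℝ (⊤ : ℕ∞) (fun x => σ x ℓ)) (ℓ : Fin n → ℤ) :
    ContDiff ℝ (⊤ : ℕ∞) (fun y => itd L (σ y) ℓ) := by
  induction L generalizing ℓ with
  | nil => exact hsm ℓ
  | cons v L ih => simp only [itd_cons]; exact (ih _).sub (ih _)

theorem unit_estimate (m : ℂ) (σ : (Fin n → ℝ) → (Fin n → ℤ) → ℂ)
    (hsm : ∀ ℓ : Fin n → ℤ, ContDiff ℝ (⊤ : ℕ∞) (fun x => σ x ℓ))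
    (hest : ∀ α β : Fin n → ℕ, ∃ C > 0, ∀ (x : Fin n → ℝ) (ℓ : Fin n → ℤ),
      ‖pderivPow β (fun y => DeltaPow α (σ y) ℓ) x‖ ≤ C * jap ℓ ^ (m.re - ∑ j, (α j : ℝ)))
    (w : List (Fin n ⊕ Fin n)) :
    ∃ C > 0, ∃ a b : ℕ, a + b = w.length ∧ ∀ r : ℕ, 0 < r → ∀ k : Fin n ⊕ Fin n → ℤ,
      ‖itd (w.map fun i => (Pi.single i 1 : Fin n ⊕ Fin n → ℤ)) (Sg m σ r) k‖ ≤
        (r : ℝ) ^ (-m.re) * (C * jap (fun j => k (Sum.inr j)) ^ (m.re - a) * (1 / r : ℝ) ^ b) := by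
  obtain ⟨C, hC, H⟩ := hest (fun j => w.count (Sum.inr j)) (fun j => w.count (Sum.inl j))
  have hp := perm_sw w
  set α : Fin n → ℕ := fun j => w.count (Sum.inr j) with hα
  set β : Fin n → ℕ := fun j => w.count (Sum.inl j) with hβ
  refine ⟨C, hC, (sw α).length, (sw β).length, ?_, fun r hr k => ?_⟩
  · rw [hp.length_eq]; simp [add_comm]
  have hr' : (0:ℝ) < r := by exact_mod_cast hr
  rw [itd_perm (hp.map _), List.map_append, itd_append]
  have e1 : itd (((sw α).map Sum.inr).map fun i => (Pi.single i 1 : Fin n ⊕ Fin n → ℤ))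
      (Sg m σ r) = fun k => (r : ℂ) ^ (-m) * DeltaPow α (σ (fun i => (k (Sum.inl i) : ℝ) / r))
        (fun i => k (Sum.inr i)) := by
    funext k
    have := itd_inr (sw α) (fun a b => (r : ℂ) ^ (-m) * σ (fun i => (a i : ℝ) / r) b) k
    unfold Sg
    rw [this, itd_smul, DeltaPow_eq]
  rw [e1, itd_smul, itd_inl (sw β) r (fun y ℓ => DeltaPow α (σ y) ℓ), norm_mul,
    Complex.norm_natCast_cpow_of_pos hr, Complex.neg_re]
  refine mul_le_mul_of_nonneg_left ?_ (by positivity)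
  refine mvt_itd (sw β) _ ?_ (1 / r) (by positivity) _ ?_ _
  · simp only [DeltaPow_eq]; exact itd_contDiff _ σ hsm _
  · intro x
    have := H x (fun i => k (Sum.inr i))
    rw [pderivPow_eq] at this
    rw [length_sw]
    push_cast
    exact this

theorem jap_bounds (k : Fin n → ℤ) (r : ℕ) (hr : 0 < r) (c : ℝ) (hc : 0 < c)
    (h1 : c ≤ ‖fun j => (k j : ℝ) / r‖) (h2 : ‖fun j => (k j : ℝ) / r‖ ≤ 3 * c) :
    c * r ≤ jap k ∧ jap k ≤ Real.sqrt (1 + n * (3 * c) ^ 2) * r := by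
  have hr' : (1:ℝ) ≤ r := by exact_mod_cast hr
  have hr0 : (0:ℝ) < r := by linarith
  constructor
  · unfold jap
    apply Real.le_sqrt_of_sq_le
    by_contra hcon
    push Not at hcon
    have : ‖fun j => (k j : ℝ) / r‖ < c := by
      rw [pi_norm_lt_iff hc]
      intro j
      rw [Real.norm_eq_abs]
      apply abs_lt_of_sq_lt_sq _ hc.le
      rw [div_pow, div_lt_iff₀ (by positivity)]
      have : (k j : ℝ) ^ 2 ≤ ∑ i, (k i : ℝ) ^ 2 :=
        Finset.single_le_sum (f := fun i => (k i : ℝ) ^ 2) (fun i _ => sq_nonneg _)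
          (Finset.mem_univ j)
      nlinarith
    linarith
  · unfold jap
    rw [← Real.sqrt_sq hr0.le, ← Real.sqrt_mul (by positivity)]
    apply Real.sqrt_le_sqrt
    have : ∑ i, (k i : ℝ) ^ 2 ≤ ∑ _i : Fin n, (3 * c) ^ 2 * (r : ℝ) ^ 2 := by
      refine Finset.sum_le_sum fun i _ => ?_
      have h3 := (norm_le_pi_norm (fun j => (k j : ℝ) / r) i).trans h2
      rw [Real.norm_eq_abs] at h3
      have h4 : ((k i : ℝ) / r) ^ 2 ≤ (3 * c) ^ 2 := by
        rw [← sq_abs]; exact pow_le_pow_left₀ (abs_nonneg _) h3 2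
      rwa [div_pow, div_le_iff₀ (by positivity)] at h4
    simp only [Finset.sum_const, Finset.card_univ, Fintype.card_fin, nsmul_eq_mul] at this
    nlinarith

theorem rpow_between (a b y s : ℝ) (ha : 0 < a) (h1 : a ≤ y) (h2 : y ≤ b) :
    y ^ s ≤ a ^ s + b ^ s := by
  have hb : 0 < b := by linarith
  rcases le_total 0 s with hs | hs
  · have := Real.rpow_le_rpow (by linarith) h2 hs
    have := Real.rpow_nonneg ha.le s
    linarith
  · have := Real.rpow_le_rpow_of_nonpos ha h1 hs
    have := Real.rpow_nonneg hb.le s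
    linarith

/-- The rescaled lattice embedding. -/
noncomputable def phi {ι : Type*} (r : ℕ) : (ι → ℤ) →+ (ι → ℝ) where
  toFun k := fun i => (k i : ℝ) / r
  map_zero' := by ext; simp
  map_add' := by intro a b; ext; simp [add_div]

theorem xi_bounds (p q : Fin n ⊕ Fin n → ℝ) (_hp : (fun j => p (Sum.inr j)) ≠ 0)
    (hq : dist q p < ‖fun j => p (Sum.inr j)‖ / 2) :
    ‖fun j => p (Sum.inr j)‖ / 2 ≤ ‖fun j => q (Sum.inr j)‖ ∧
    ‖fun j => q (Sum.inr j)‖ ≤ 3 * (‖fun j => p (Sum.inr j)‖ / 2) := by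
  have h : ‖(fun j => q (Sum.inr j)) - (fun j => p (Sum.inr j))‖ ≤ dist q p := by
    rw [pi_norm_le_iff_of_nonneg dist_nonneg]
    intro j
    have := dist_le_pi_dist q p (Sum.inr j)
    rwa [dist_eq_norm] at this
  have h1 := norm_sub_norm_le (fun j => q (Sum.inr j)) (fun j => p (Sum.inr j))
  have h2 := norm_sub_norm_le (fun j => p (Sum.inr j)) (fun j => q (Sum.inr j))
  rw [norm_sub_rev] at h2
  constructor <;> linarith

theorem unit_estimate_local (m : ℂ) (σ : (Fin n → ℝ) → (Fin n → ℤ) → ℂ)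
    (hsm : ∀ ℓ : Fin n → ℤ, ContDiff ℝ (⊤ : ℕ∞) (fun x => σ x ℓ))
    (hest : ∀ α β : Fin n → ℕ, ∃ C > 0, ∀ (x : Fin n → ℝ) (ℓ : Fin n → ℤ),
      ‖pderivPow β (fun y => DeltaPow α (σ y) ℓ) x‖ ≤ C * jap ℓ ^ (m.re - ∑ j, (α j : ℝ)))
    (p : Fin n ⊕ Fin n → ℝ) (hp : (fun j => p (Sum.inr j)) ≠ 0)
    (w : List (Fin n ⊕ Fin n)) :
    ∃ C : ℝ, 0 ≤ C ∧ ∀ r : ℕ, 0 < r → ∀ k : Fin n ⊕ Fin n → ℤ,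
      dist (phi r k) p < ‖fun j => p (Sum.inr j)‖ / 2 →
      ‖itd (w.map fun i => (Pi.single i 1 : Fin n ⊕ Fin n → ℤ)) (Sg m σ r) k‖ ≤
        C * (1 / r : ℝ) ^ w.length := by
  obtain ⟨C, hC, a, b, hab, H⟩ := unit_estimate m σ hsm hest w
  set c := ‖fun j => p (Sum.inr j)‖ / 2 with hc
  have hcp : 0 < c := by have := norm_pos_iff.2 hp; positivity
  set B := Real.sqrt (1 + n * (3 * c) ^ 2) with hB
  refine ⟨C * (c ^ (m.re - a) + B ^ (m.re - a)), by positivity, fun r hr k hk => ?_⟩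
  have hr0 : (0:ℝ) < r := by exact_mod_cast hr
  obtain ⟨x1, x2⟩ := xi_bounds p _ hp hk
  obtain ⟨j1, j2⟩ := jap_bounds (fun j => k (Sum.inr j)) r hr c hcp x1 x2
  have j3 := rpow_between _ _ _ (m.re - a) (by positivity) j1 j2
  rw [Real.mul_rpow hcp.le hr0.le, Real.mul_rpow (by positivity) hr0.le, ← add_mul] at j3
  refine (H r hr k).trans ?_
  have e : (r : ℝ) ^ (-m.re) * (r : ℝ) ^ (m.re - a) * (1 / r : ℝ) ^ b = (1 / r : ℝ) ^ w.length := by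
    rw [← Real.rpow_add hr0, ← hab, pow_add]
    congr 1
    rw [show -m.re + (m.re - a) = -(a : ℝ) by ring, Real.rpow_neg hr0.le, Real.rpow_natCast]
    simp
  rw [← e]
  have : (r : ℝ) ^ (-m.re) * (C * jap (fun j => k (Sum.inr j)) ^ (m.re - a) * (1 / r : ℝ) ^ b) ≤
    (r : ℝ) ^ (-m.re) * (C * ((c ^ (m.re - a) + B ^ (m.re - a)) * (r : ℝ) ^ (m.re - a))
      * (1 / r : ℝ) ^ b) := by gcongr
  refine this.trans (le_of_eq ?_)
  ring

theorem telescoping {ι : Type*} [Fintype ι] [DecidableEq ι] (r : ℕ) (hr : 0 < r) (p : ι → ℝ)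
    (ε : ℝ) (L : List (ι × ℕ)) (S : (ι → ℤ) → ℂ) (M : ℝ)
    (H : ∀ k, dist (phi r k) p < ε →
      ‖itd ((L.map Prod.fst).map fun i => (Pi.single i 1 : ι → ℤ)) S k‖ ≤ M)
    (k : ι → ℤ) (hk : dist (phi r k) p + (L.map fun a => (a.2 : ℝ) / r).sum < ε) :
    ‖itd (L.map fun a => (Pi.single a.1 (a.2 : ℤ) : ι → ℤ)) S k‖ ≤
      M * (L.map fun a => (a.2 : ℝ)).prod := by
  have hr0 : (0:ℝ) < r := by exact_mod_cast hr
  induction L generalizing S k with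
  | nil => simpa [itd_nil] using H k (by simpa using hk)
  | cons c L ih =>
    obtain ⟨i, a⟩ := c
    set T := itd (L.map fun a => (Pi.single a.1 (a.2 : ℤ) : ι → ℤ)) S with hT
    have hdd : ∀ k, T (k + Pi.single i 1) - T k =
        itd (L.map fun a => (Pi.single a.1 (a.2 : ℤ) : ι → ℤ)) (dd (Pi.single i 1) S) k := by
      intro k
      have : T (k + Pi.single i 1) - T k =
        itd (Pi.single i 1 :: L.map fun a => (Pi.single a.1 (a.2 : ℤ) : ι → ℤ)) S k := rfl
      rw [this, ← itd_perm (List.perm_append_singleton _ _), itd_append]; rfl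
    simp only [List.map_cons, List.sum_cons, List.prod_cons] at hk ⊢
    have hb : ∀ b ∈ Finset.range a, ‖T (k + Pi.single i ((b + 1 : ℕ) : ℤ)) -
        T (k + Pi.single i (b : ℤ))‖ ≤ M * (L.map fun a => (a.2 : ℝ)).prod := by
      intro b hb
      have hba : (b : ℝ) ≤ a := by exact_mod_cast (Finset.mem_range.1 hb).le
      have e : k + (Pi.single i ((b + 1 : ℕ) : ℤ) : ι → ℤ) =
          k + Pi.single i (b : ℤ) + Pi.single i 1 := by
        rw [add_assoc, ← Pi.single_add]; push_cast; rfl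
      rw [e, hdd]
      refine ih _ ?_ _ ?_
      · intro k' hk'
        have := H k' hk'
        rw [List.map_cons, List.map_cons, ← itd_perm (List.perm_append_singleton _ _),
          itd_append] at this
        exact this
      · have h1 : dist (phi r (k + Pi.single i (b : ℤ))) (phi r k) ≤ (a : ℝ) / r := by
          rw [map_add, dist_self_add_left]
          have : phi r (Pi.single i (b : ℤ)) = (Pi.single i ((b : ℝ) / r) : ι → ℝ) := by
            ext j
            rcases eq_or_ne j i with rfl | h <;> simp [phi, *]
          rw [this, Pi.norm_single, Real.norm_of_nonneg (by positivity)]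
          gcongr
        have h2 := dist_triangle (phi r (k + Pi.single i (b : ℤ))) (phi r k) p
        linarith
    have e : itd ((Pi.single i (a : ℤ) : ι → ℤ) ::
        L.map fun a => (Pi.single a.1 (a.2 : ℤ) : ι → ℤ)) S k =
        ∑ b ∈ Finset.range a, (T (k + Pi.single i ((b + 1 : ℕ) : ℤ)) -
        T (k + Pi.single i (b : ℤ))) := by
      have := Finset.sum_range_sub (fun b : ℕ => T (k + (Pi.single i (b : ℤ) : ι → ℤ))) a
      rw [this]
      simp [itd_cons, hT]
    rw [e]
    refine (norm_sum_le_of_le _ hb).trans (le_of_eq ?_)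
    simp only [Finset.sum_const, Finset.card_range, nsmul_eq_mul]
    ring

theorem grid_estimate (m : ℂ) (σ : (Fin n → ℝ) → (Fin n → ℤ) → ℂ)
    (hsm : ∀ ℓ : Fin n → ℤ, ContDiff ℝ (⊤ : ℕ∞) (fun x => σ x ℓ))
    (hest : ∀ α β : Fin n → ℕ, ∃ C > 0, ∀ (x : Fin n → ℝ) (ℓ : Fin n → ℤ),
      ‖pderivPow β (fun y => DeltaPow α (σ y) ℓ) x‖ ≤ C * jap ℓ ^ (m.re - ∑ j, (α j : ℝ)))
    (p : Fin n ⊕ Fin n → ℝ) (hp : (fun j => p (Sum.inr j)) ≠ 0)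
    (w : List (Fin n ⊕ Fin n)) :
    ∃ C : ℝ, 0 ≤ C ∧ ∀ Φ : (Fin n ⊕ Fin n → ℝ) → ℂ,
      (∀ r : ℕ, 0 < r → ∀ k : Fin n ⊕ Fin n → ℤ, (fun j => k (Sum.inr j)) ≠ 0 →
        Φ (phi r k) = Sg m σ r k) →
      ∀ r : ℕ, 0 < r → ∀ L : List ((Fin n ⊕ Fin n) × ℕ), L.map Prod.fst = w →
      ∀ k : Fin n ⊕ Fin n → ℤ,
      dist (phi r k) p + (L.map fun a => (a.2 : ℝ) / r).sum < ‖fun j => p (Sum.inr j)‖ / 2 →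
      ‖itd (L.map fun a => (Pi.single a.1 ((a.2 : ℝ) / r) : Fin n ⊕ Fin n → ℝ)) Φ (phi r k)‖ ≤
        C * (L.map fun a => (a.2 : ℝ) / r).prod := by
  obtain ⟨C, hC, H⟩ := unit_estimate_local m σ hsm hest p hp w
  refine ⟨C, hC, fun Φ hΦ r hr L hL k hk => ?_⟩
  have hr0 : (0:ℝ) < r := by exact_mod_cast hr
  have hcp : 0 < ‖fun j => p (Sum.inr j)‖ / 2 := by have := norm_pos_iff.2 hp; positivity
  have hphi : ∀ a : (Fin n ⊕ Fin n) × ℕ, (Pi.single a.1 ((a.2 : ℝ) / r) : Fin n ⊕ Fin n → ℝ) =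
      phi r (Pi.single a.1 (a.2 : ℤ)) := by
    intro a
    ext j
    rcases eq_or_ne j a.1 with rfl | h <;> simp [phi, *]
  have e1 : (L.map fun a => (Pi.single a.1 ((a.2 : ℝ) / r) : Fin n ⊕ Fin n → ℝ)) =
      (L.map fun a => (Pi.single a.1 (a.2 : ℤ) : Fin n ⊕ Fin n → ℤ)).map (phi r) := by
    rw [List.map_map]
    exact List.map_congr_left fun a _ => hphi a
  rw [e1, itd_hom]
  have e2 : itd (L.map fun a => (Pi.single a.1 (a.2 : ℤ) : Fin n ⊕ Fin n → ℤ))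
      (fun a => Φ (phi r a)) k =
      itd (L.map fun a => (Pi.single a.1 (a.2 : ℤ) : Fin n ⊕ Fin n → ℤ)) (Sg m σ r) k := by
    apply itd_congr
    intro M hM
    obtain ⟨M', hM', rfl⟩ := List.sublist_map_iff.1 hM
    apply hΦ r hr
    have := region_mem (M'.map fun a => (a.1, (a.2 : ℝ) / r)) (L.map fun a => (a.1, (a.2 : ℝ) / r))
      (hM'.map _) (by
        intro a ha
        obtain ⟨b, _, rfl⟩ := List.mem_map.1 ha
        positivity) p (phi r k) _ (by simpa [List.map_map, Function.comp_def] using hk)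
    rw [List.map_map] at this
    have e3 : (M'.map ((fun a => (Pi.single a.1 a.2 : Fin n ⊕ Fin n → ℝ)) ∘
        fun a => (a.1, (a.2 : ℝ) / r))).sum =
        phi r (M'.map fun a => (Pi.single a.1 (a.2 : ℤ) : Fin n ⊕ Fin n → ℤ)).sum := by
      rw [map_list_sum, List.map_map]
      exact congrArg List.sum (List.map_congr_left fun a _ => hphi a)
    rw [e3, ← map_add] at this
    have h5 := (xi_bounds p _ hp this).1
    intro h0
    have h6 : (fun j => phi r (k + (M'.map fun a =>
        (Pi.single a.1 (a.2 : ℤ) : Fin n ⊕ Fin n → ℤ)).sum) (Sum.inr j)) = 0 := by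
      ext j
      have := congrFun h0 j
      simp only [phi, AddMonoidHom.coe_mk, ZeroHom.coe_mk, Pi.zero_apply] at this ⊢
      rw [this]; simp
    rw [h6, norm_zero] at h5
    linarith
  rw [e2]
  refine (telescoping r hr p _ L (Sg m σ r) _ (fun k hk => by rw [hL]; exact H r hr k hk) k
    hk).trans (le_of_eq ?_)
  rw [mul_assoc]
  congr 1
  rw [← hL, List.length_map]
  clear hL hk e1 e2
  induction L with
  | nil => simp
  | cons a L ih =>
    simp only [List.length_cons, List.map_cons, List.prod_cons, ← ih, pow_succ]
    ring

end Words
/-! ### The extension -/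

section Extension

variable {n : ℕ}

open Classical in
/-- The homogeneous extension to points with rational frequency. -/
noncomputable def F0 (m : ℂ) (σ : (Fin n → ℝ) → (Fin n → ℤ) → ℂ) (q : Fin n ⊕ Fin n → ℝ) : ℂ :=
  if h : ∃ (r : ℕ) (ℓ : Fin n → ℤ), 0 < r ∧ ∀ j, q (Sum.inr j) = (ℓ j : ℝ) / r then
    (h.choose : ℂ) ^ (-m) * σ (fun i => q (Sum.inl i)) h.choose_spec.choose
  else 0

theorem F0_eq (m : ℂ) (σ : (Fin n → ℝ) → (Fin n → ℤ) → ℂ)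
    (hhom : ∀ (x : Fin n → ℝ) (ℓ : Fin n → ℤ), ℓ ≠ 0 → ∀ r : ℕ, 0 < r →
      σ x ((r : ℤ) • ℓ) = (r : ℂ) ^ m * σ x ℓ)
    (q : Fin n ⊕ Fin n → ℝ) (r : ℕ) (hr : 0 < r) (ℓ : Fin n → ℤ) (hℓ : ℓ ≠ 0)
    (hq : ∀ j, q (Sum.inr j) = (ℓ j : ℝ) / r) :
    F0 m σ q = (r : ℂ) ^ (-m) * σ (fun i => q (Sum.inl i)) ℓ := by
  have h : ∃ (r : ℕ) (ℓ : Fin n → ℤ), 0 < r ∧ ∀ j, q (Sum.inr j) = (ℓ j : ℝ) / r :=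
    ⟨r, ℓ, hr, hq⟩
  rw [F0, dif_pos h]
  obtain ⟨hr', hq'⟩ := h.choose_spec.choose_spec
  set r' := h.choose
  set ℓ' := h.choose_spec.choose
  have hr0 : (r : ℝ) ≠ 0 := by exact_mod_cast hr.ne'
  have hr0' : (r' : ℝ) ≠ 0 := by exact_mod_cast hr'.ne'
  have e : (r : ℤ) • ℓ' = (r' : ℤ) • ℓ := by
    ext j
    have := (hq' j).symm.trans (hq j)
    rw [div_eq_div_iff hr0' hr0] at this
    have h2 : ℓ' j * (r : ℤ) = ℓ j * (r' : ℤ) := by exact_mod_cast this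
    simp only [Pi.smul_apply, smul_eq_mul]
    linarith
  have hℓ' : ℓ' ≠ 0 := by
    rintro h0
    rw [h0, smul_zero] at e
    rcases smul_eq_zero.1 e.symm with h1 | h1
    · exact hr'.ne' (by exact_mod_cast h1)
    · exact hℓ h1
  have h1 := hhom (fun i => q (Sum.inl i)) ℓ' hℓ' r hr
  have h2 := hhom (fun i => q (Sum.inl i)) ℓ hℓ r' hr'
  rw [e, h2] at h1
  have hc : (r : ℂ) ^ m ≠ 0 := by
    rw [Ne, Complex.cpow_eq_zero_iff]; simp [hr.ne']
  have hc' : (r' : ℂ) ^ m ≠ 0 := by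
    rw [Ne, Complex.cpow_eq_zero_iff]; simp [hr'.ne']
  rw [Complex.cpow_neg, Complex.cpow_neg]
  show ((r' : ℂ) ^ m)⁻¹ * σ (fun i => q (Sum.inl i)) ℓ' = _
  rw [inv_mul_eq_div, inv_mul_eq_div, div_eq_div_iff hc' hc]
  linear_combination -h1

theorem common_denominator {κ : Type*} [Fintype κ] (q : κ → ℝ)
    (hq : ∀ i, q i ∈ Set.range ((↑) : ℚ → ℝ)) :
    ∃ r : ℕ, 0 < r ∧ ∃ k : κ → ℤ, ∀ i, q i = (k i : ℝ) / r := by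
  classical
  choose a ha using hq
  refine ⟨∏ i, (a i).den, Finset.prod_pos fun i _ => (a i).den_pos,
    fun i => (a i).num * ∏ j ∈ Finset.univ.erase i, ((a j).den : ℤ), fun i => ?_⟩
  have h1 : (∏ j, (a j).den) = (a i).den * ∏ j ∈ Finset.univ.erase i, (a j).den :=
    (Finset.mul_prod_erase _ _ (Finset.mem_univ i)).symm
  have h2 : ((∏ j ∈ Finset.univ.erase i, (a j).den : ℕ) : ℝ) ≠ 0 := by
    exact_mod_cast (Finset.prod_pos fun j _ => (a j).den_pos).ne'
  rw [h1, ← ha i]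
  push_cast at h2 ⊢
  rw [mul_div_mul_right _ _ h2]
  exact_mod_cast (Rat.num_div_den (a i)).symm

theorem floor_tendsto (x : ℝ) :
    Filter.Tendsto (fun r : ℕ => (⌊(r : ℝ) * x⌋ : ℝ) / r) Filter.atTop (nhds x) := by
  have t : Filter.Tendsto (fun r : ℕ => x - 1 / (r : ℝ)) Filter.atTop (nhds (x - 0)) :=
    tendsto_const_nhds.sub (tendsto_const_div_atTop_nhds_zero_nat 1)
  rw [sub_zero] at t
  refine tendsto_of_tendsto_of_tendsto_of_le_of_le' t tendsto_const_nhds ?_ ?_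
  · filter_upwards [Filter.eventually_gt_atTop 0] with r hr
    have hr0 : (0:ℝ) < r := by exact_mod_cast hr
    rw [le_div_iff₀ hr0, sub_mul, one_div, inv_mul_cancel₀ hr0.ne']
    have := Int.lt_floor_add_one ((r : ℝ) * x)
    linarith
  · filter_upwards [Filter.eventually_gt_atTop 0] with r hr
    have hr0 : (0:ℝ) < r := by exact_mod_cast hr
    rw [div_le_iff₀ hr0]
    have := Int.floor_le ((r : ℝ) * x)
    linarith

theorem nat_floor_tendsto (x : ℝ) (hx : 0 ≤ x) :
    Filter.Tendsto (fun r : ℕ => (⌊(r : ℝ) * x⌋₊ : ℝ) / r) Filter.atTop (nhds x) := by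
  have a := (tendsto_nat_floor_mul_div_atTop (R := ℝ) (a := x) hx).comp
      tendsto_natCast_atTop_atTop
  refine a.congr fun r => ?_
  simp [Function.comp, mul_comm]

theorem isOpen_U : IsOpen {p : Fin n ⊕ Fin n → ℝ | (fun j => p (Sum.inr j)) ≠ 0} := by
  have : Continuous fun p : Fin n ⊕ Fin n → ℝ => fun j => p (Sum.inr j) := by fun_prop
  exact isOpen_ne.preimage this

theorem exists_ext (m : ℂ) (σ : (Fin n → ℝ) → (Fin n → ℤ) → ℂ)
    (hsm : ∀ ℓ : Fin n → ℤ, ContDiff ℝ (⊤ : ℕ∞) (fun x => σ x ℓ))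
    (hest : ∀ α β : Fin n → ℕ, ∃ C > 0, ∀ (x : Fin n → ℝ) (ℓ : Fin n → ℤ),
      ‖pderivPow β (fun y => DeltaPow α (σ y) ℓ) x‖ ≤ C * jap ℓ ^ (m.re - ∑ j, (α j : ℝ)))
    (hhom : ∀ (x : Fin n → ℝ) (ℓ : Fin n → ℤ), ℓ ≠ 0 → ∀ r : ℕ, 0 < r →
      σ x ((r : ℤ) • ℓ) = (r : ℂ) ^ m * σ x ℓ) :
    ∃ F : (Fin n ⊕ Fin n → ℝ) → ℂ, Good {p | (fun j => p (Sum.inr j)) ≠ 0} F ∧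
      ∀ q, (∀ i, q i ∈ Set.range ((↑) : ℚ → ℝ)) → (fun j => q (Sum.inr j)) ≠ 0 →
        F q = F0 m σ q := by
  set U : Set (Fin n ⊕ Fin n → ℝ) := {p | (fun j => p (Sum.inr j)) ≠ 0} with hU
  set D : Set (Fin n ⊕ Fin n → ℝ) := {q | ∀ i, q i ∈ Set.range ((↑) : ℚ → ℝ)} with hD
  have hphiD : ∀ r k, phi r k ∈ D := fun r k i => ⟨(k i : ℚ) / r, by simp [phi]⟩
  have hS : ∀ r : ℕ, 0 < r → ∀ k : Fin n ⊕ Fin n → ℤ, (fun j => k (Sum.inr j)) ≠ 0 →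
      F0 m σ (phi r k) = Sg m σ r k := by
    intro r hr k hk
    rw [F0_eq m σ hhom (phi r k) r hr _ hk (fun j => rfl)]
    rfl
  have hdense : ∀ q, q ∈ closure D := by
    intro q
    refine mem_closure_of_tendsto (f := fun r : ℕ => phi r fun i => ⌊(r : ℝ) * q i⌋)
      (b := Filter.atTop) ?_ (Filter.Eventually.of_forall fun r => hphiD _ _)
    exact tendsto_pi_nhds.2 fun i => floor_tendsto (q i)
  have hlim : ∀ p ∈ U, ∃ y, Filter.Tendsto (F0 m σ) (nhdsWithin p D) (nhds y) := by
    intro p hp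
    set ε := ‖fun j => p (Sum.inr j)‖ / 2 with hε
    have hεp : 0 < ε := by have := norm_pos_iff.2 hp; positivity
    choose C hC0 hC using fun i => grid_estimate m σ hsm hest p hp [i]
    have hCs : 0 ≤ ∑ j, C j := Finset.sum_nonneg fun j _ => hC0 j
    have lip := coord_lipschitz (F0 m σ) (Set.range ((↑) : ℚ → ℝ)) p (ε / 3) (∑ j, C j) (by
      intro q hq hqd i s hs hqs hqs'
      have hsS : s ∈ Set.range ((↑) : ℚ → ℝ) := by
        obtain ⟨a, ha⟩ := hqs
        obtain ⟨b, hb⟩ := hq i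
        exact ⟨a - b, by push_cast; rw [ha, hb]; ring⟩
      obtain ⟨r, hr, k, hk⟩ := common_denominator (κ := Option (Fin n ⊕ Fin n))
        (fun o => o.elim s q) (by rintro (_ | i); exacts [hsS, hq i])
      have hr0 : (0:ℝ) < r := by exact_mod_cast hr
      have hks : s = (k none : ℝ) / r := hk none
      have hk0 : 0 ≤ k none := by
        rw [hks, lt_div_iff₀ hr0, zero_mul] at hs
        exact_mod_cast hs.le
      obtain ⟨a, ha⟩ := Int.eq_ofNat_of_zero_le hk0
      have hsa : s = (a : ℝ) / r := by rw [hks, ha]; simp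
      have hqk : q = phi r fun i => k (some i) := by ext i; exact hk (some i)
      have hqi : |q i - p i| < ε / 3 := by
        rw [← Real.dist_eq]; exact (dist_le_pi_dist q p i).trans_lt hqd
      have := hC i (F0 m σ) hS r hr [(i, a)] rfl (fun i => k (some i)) (by
        simp only [List.map_cons, List.map_nil, List.sum_cons, List.sum_nil]
        rw [← hqk, ← hsa]
        rw [abs_lt] at hqi hqs'
        linarith)
      simp only [List.map_cons, List.map_nil, itd_cons, itd_nil, List.prod_cons, List.prod_nil,
        mul_one] at this
      rw [← hqk, ← hsa] at this
      refine this.trans (mul_le_mul_of_nonneg_right ?_ hs.le)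
      exact Finset.single_le_sum (fun j _ => hC0 j) (Finset.mem_univ i))
    have : (nhdsWithin p D).NeBot := mem_closure_iff_nhdsWithin_neBot.1 (hdense p)
    apply cauchy_map_iff_exists_tendsto.1
    rw [Metric.cauchy_iff]
    refine ⟨this.map _, fun η hη => ?_⟩
    set B := (∑ j, C j) * Fintype.card (Fin n ⊕ Fin n) with hB
    have hB0 : 0 ≤ B := by positivity
    set δ := min (ε / 3) (η / (2 * (B + 1))) with hδ
    have hδp : 0 < δ := by positivity
    refine ⟨F0 m σ '' (D ∩ Metric.ball p δ), Filter.image_mem_map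
      (Filter.inter_mem self_mem_nhdsWithin (mem_nhdsWithin_of_mem_nhds
        (Metric.ball_mem_nhds p hδp))), ?_⟩
    rintro _ ⟨u, ⟨hu, hu'⟩, rfl⟩ _ ⟨v, ⟨hv, hv'⟩, rfl⟩
    rw [Metric.mem_ball] at hu' hv'
    rw [dist_eq_norm]
    have h1 := lip v u hv hu (hv'.trans_le (min_le_left _ _)) (hu'.trans_le (min_le_left _ _))
    have h2 := mul_le_mul_of_nonneg_left (sum_abs_le_card u v) hCs
    have h3 : dist u v < 2 * δ := by
      have := dist_triangle_right u v p
      linarith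
    have h4 : 2 * δ ≤ η / (B + 1) := by
      have : δ ≤ η / (2 * (B + 1)) := min_le_right _ _
      calc 2 * δ ≤ 2 * (η / (2 * (B + 1))) := by linarith
        _ = η / (B + 1) := by field_simp
    have h5 := h3.trans_le h4
    rw [lt_div_iff₀ (by positivity)] at h5
    have : 0 ≤ dist u v := dist_nonneg
    nlinarith
  set F := extendFrom D (F0 m σ) with hF
  have hFc : ContinuousOn F U := continuousOn_extendFrom (fun q _ => hdense q) hlim
  have hFc' : ∀ p ∈ U, ContinuousAt F p := fun p hp => hFc.continuousAt (isOpen_U.mem_nhds hp)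
  have hFD : ∀ q ∈ D, q ∈ U → F q = F0 m σ q := by
    intro q hqD hqU
    obtain ⟨y, hy⟩ := hlim q hqU
    rw [hF, extendFrom_eq (hdense q) hy]
    have h1 : Filter.Tendsto (F0 m σ) (pure q) (nhds y) := hy.mono_left (pure_le_nhdsWithin hqD)
    exact (tendsto_nhds_unique h1 (tendsto_pure_nhds _ _))
  have hS' : ∀ r : ℕ, 0 < r → ∀ k : Fin n ⊕ Fin n → ℤ, (fun j => k (Sum.inr j)) ≠ 0 →
      F (phi r k) = Sg m σ r k := by
    intro r hr k hk
    have hr0 : (r : ℝ) ≠ 0 := by exact_mod_cast hr.ne'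
    rw [hFD _ (hphiD r k), hS r hr k hk]
    intro h0
    apply hk
    ext j
    have := congrFun h0 j
    simpa [phi, hr.ne'] using this
  refine ⟨F, ?_, hFD⟩
  intro p hp
  set ε := ‖fun j => p (Sum.inr j)‖ / 2 with hε
  have hεp : 0 < ε := by have := norm_pos_iff.2 hp; positivity
  refine ⟨ε, hεp, fun w => ?_⟩
  obtain ⟨C, hC0, hC⟩ := grid_estimate m σ hsm hest p hp w
  refine ⟨C, hC0, fun L hL hpos q hq => ?_⟩
  have hnn : ∀ a ∈ L, 0 ≤ a.2 := fun a ha => (hpos a ha).le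
  have tq : Filter.Tendsto (fun r : ℕ => phi r fun i => ⌊(r : ℝ) * q i⌋) Filter.atTop (nhds q) :=
    tendsto_pi_nhds.2 fun i => floor_tendsto (q i)
  have T := itd_tendsto (l := (Filter.atTop : Filter ℕ)) L
    (fun r a => (Pi.single a.1 ((⌊(r : ℝ) * a.2⌋₊ : ℝ) / r) : Fin n ⊕ Fin n → ℝ))
    (fun a => (Pi.single a.1 a.2 : Fin n ⊕ Fin n → ℝ)) (fun _ => F) F
    (fun r => phi r fun i => ⌊(r : ℝ) * q i⌋) q (by
      intro M hM
      have hm : q + (M.map fun a => (Pi.single a.1 a.2 : Fin n ⊕ Fin n → ℝ)).sum ∈ U := by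
        intro h0
        have := (xi_bounds p _ hp (region_mem M L hM hnn p q ε hq)).1
        rw [h0, norm_zero] at this
        linarith
      refine (hFc' _ hm).tendsto.comp (tq.add ?_)
      refine tendsto_list_sum M fun a ha => ?_
      have hc : Continuous (fun t : ℝ => (Pi.single a.1 t : Fin n ⊕ Fin n → ℝ)) :=
        continuous_single (A := fun _ : Fin n ⊕ Fin n => ℝ) a.1
      exact (hc.tendsto _).comp (nat_floor_tendsto a.2 (hnn a (hM.subset ha))))
  have tp : Filter.Tendsto (fun r : ℕ => (L.map fun a => (⌊(r : ℝ) * a.2⌋₊ : ℝ) / r).prod)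
      Filter.atTop (nhds (L.map Prod.snd).prod) :=
    tendsto_list_prod L fun a ha => nat_floor_tendsto a.2 (hnn a ha)
  have ts : Filter.Tendsto (fun r : ℕ => (L.map fun a => (⌊(r : ℝ) * a.2⌋₊ : ℝ) / r).sum)
      Filter.atTop (nhds (L.map Prod.snd).sum) :=
    tendsto_list_sum L fun a ha => nat_floor_tendsto a.2 (hnn a ha)
  refine le_of_tendsto_of_tendsto T.norm (tp.const_mul C) ?_
  have td := (tq.dist (tendsto_const_nhds (x := p))).add ts
  filter_upwards [td.eventually_lt_const hq, Filter.eventually_gt_atTop 0] with r h1 h2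
  have := hC F hS' r h2 (L.map fun a => (a.1, ⌊(r : ℝ) * a.2⌋₊))
    (by rw [List.map_map, ← hL]; rfl) (fun i => ⌊(r : ℝ) * q i⌋)
    (by rw [List.map_map]; exact h1)
  rw [List.map_map, List.map_map] at this
  exact this

theorem eq_of_dense (f g : (Fin n → ℝ) → ℂ) (hf : ContinuousOn f {ξ | ξ ≠ 0})
    (hg : ContinuousOn g {ξ | ξ ≠ 0})
    (h : ∀ r : ℕ, 0 < r → ∀ ℓ : Fin n → ℤ, ℓ ≠ 0 →
      f ((r : ℝ)⁻¹ • latt ℓ) = g ((r : ℝ)⁻¹ • latt ℓ))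
    (ξ : Fin n → ℝ) (hξ : ξ ≠ 0) : f ξ = g ξ := by
  have hn : {ξ : Fin n → ℝ | ξ ≠ 0} ∈ nhds ξ := isOpen_ne.mem_nhds hξ
  have t : Filter.Tendsto (fun r : ℕ => (r : ℝ)⁻¹ • latt fun i => ⌊(r : ℝ) * ξ i⌋) Filter.atTop
      (nhds ξ) := by
    refine tendsto_pi_nhds.2 fun i => (floor_tendsto (ξ i)).congr fun r => ?_
    simp [latt, div_eq_inv_mul]
  refine tendsto_nhds_unique_of_eventuallyEq ((hf.continuousAt hn).tendsto.comp t)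
    ((hg.continuousAt hn).tendsto.comp t) ?_
  filter_upwards [t hn, Filter.eventually_gt_atTop 0] with r h1 h2
  refine h r h2 _ fun h0 => h1 ?_
  show (r : ℝ)⁻¹ • latt (fun i => ⌊(r : ℝ) * ξ i⌋) = 0
  rw [h0]
  ext i
  simp [latt]

end Extension
/-- An `x`-dependent toroidal symbol `σ(x, ℓ)` of order `Re m` which is `m`-homogeneous in
`ℓ ≠ 0` extends uniquely to a continuous function on `ℝ^n × (ℝ^n ∖ {0})`, periodic in `x` and
`m`-homogeneous in `ξ ≠ 0`; moreover this extension is smooth. -/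
theorem exists_unique_smooth_homogeneous_extension (n : ℕ) (hn : 1 ≤ n) (m : ℂ)
    (σ : (Fin n → ℝ) → (Fin n → ℤ) → ℂ)
    (hper : ∀ (x : Fin n → ℝ) (k ℓ : Fin n → ℤ), σ (x + latt k) ℓ = σ x ℓ)
    (hsm : ∀ ℓ : Fin n → ℤ, ContDiff ℝ (⊤ : ℕ∞) (fun x => σ x ℓ))
    (hest : ∀ α β : Fin n → ℕ, ∃ C > 0, ∀ (x : Fin n → ℝ) (ℓ : Fin n → ℤ),
      ‖pderivPow β (fun y => DeltaPow α (σ y) ℓ) x‖ ≤ C * jap ℓ ^ (m.re - ∑ j, (α j : ℝ)))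
    (hhom : ∀ (x : Fin n → ℝ) (ℓ : Fin n → ℤ), ℓ ≠ 0 → ∀ r : ℕ, 0 < r →
      σ x ((r : ℤ) • ℓ) = (r : ℂ) ^ m * σ x ℓ) :
    ∃ σt : (Fin n → ℝ) → (Fin n → ℝ) → ℂ,
      (ContinuousOn (fun p : (Fin n → ℝ) × (Fin n → ℝ) => σt p.1 p.2)
          (Set.univ ×ˢ {ξ : Fin n → ℝ | ξ ≠ 0}) ∧
        (∀ (x : Fin n → ℝ) (k : Fin n → ℤ) (ξ : Fin n → ℝ), ξ ≠ 0 →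
          σt (x + latt k) ξ = σt x ξ) ∧
        (∀ (x : Fin n → ℝ) (t : ℝ), 0 < t → ∀ ξ : Fin n → ℝ, ξ ≠ 0 →
          σt x (t • ξ) = (t : ℂ) ^ m * σt x ξ) ∧
        (∀ (x : Fin n → ℝ) (ℓ : Fin n → ℤ), ℓ ≠ 0 → σt x (latt ℓ) = σ x ℓ)) ∧
      ContDiffOn ℝ (⊤ : ℕ∞) (fun p : (Fin n → ℝ) × (Fin n → ℝ) => σt p.1 p.2)
        (Set.univ ×ˢ {ξ : Fin n → ℝ | ξ ≠ 0}) ∧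
      (∀ τ : (Fin n → ℝ) → (Fin n → ℝ) → ℂ,
        (ContinuousOn (fun p : (Fin n → ℝ) × (Fin n → ℝ) => τ p.1 p.2)
            (Set.univ ×ˢ {ξ : Fin n → ℝ | ξ ≠ 0}) ∧
          (∀ (x : Fin n → ℝ) (k : Fin n → ℤ) (ξ : Fin n → ℝ), ξ ≠ 0 →
            τ (x + latt k) ξ = τ x ξ) ∧
          (∀ (x : Fin n → ℝ) (t : ℝ), 0 < t → ∀ ξ : Fin n → ℝ, ξ ≠ 0 →
            τ x (t • ξ) = (t : ℂ) ^ m * τ x ξ) ∧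
          (∀ (x : Fin n → ℝ) (ℓ : Fin n → ℤ), ℓ ≠ 0 → τ x (latt ℓ) = σ x ℓ)) →
        ∀ (x ξ : Fin n → ℝ), ξ ≠ 0 → τ x ξ = σt x ξ) := by
  obtain ⟨F, hG, hFr⟩ := exists_ext m σ hsm hest hhom
  have hlat : ∀ (r : ℕ), 0 < r → ∀ ℓ : Fin n → ℤ, ℓ ≠ 0 → (r : ℝ)⁻¹ • latt ℓ ≠ 0 := by
    intro r hr ℓ hℓ h0
    apply hℓ
    ext j
    have := congrFun h0 j
    simpa [latt, hr.ne'] using this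
  have key : ∀ (x : Fin n → ℝ) (r : ℕ), 0 < r → ∀ ℓ : Fin n → ℤ, ℓ ≠ 0 →
      F (Sum.elim x ((r : ℝ)⁻¹ • latt ℓ)) = (r : ℂ) ^ (-m) * σ x ℓ := by
    intro x r hr ℓ hℓ
    set xN : ℕ → Fin n → ℝ := fun N i => (⌊(N : ℝ) * x i⌋ : ℝ) / N with hxN
    have tx : Filter.Tendsto xN Filter.atTop (nhds x) :=
      tendsto_pi_nhds.2 fun i => floor_tendsto (x i)
    have t1 : Filter.Tendsto (fun N => Sum.elim (xN N) ((r : ℝ)⁻¹ • latt ℓ)) Filter.atTop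
        (nhds (Sum.elim x ((r : ℝ)⁻¹ • latt ℓ))) := by
      refine tendsto_pi_nhds.2 ?_
      rintro (i | j)
      · exact floor_tendsto (x i)
      · exact tendsto_const_nhds
    have hc := (Good.continuousAt hG (Sum.elim x ((r : ℝ)⁻¹ • latt ℓ)) (hlat r hr ℓ hℓ)).tendsto.comp t1
    have hs := (((hsm ℓ).continuous.tendsto x).comp tx).const_mul ((r : ℂ) ^ (-m))
    refine tendsto_nhds_unique_of_eventuallyEq hc hs (Filter.Eventually.of_forall fun N => ?_)
    show F (Sum.elim (xN N) ((r : ℝ)⁻¹ • latt ℓ)) = (r : ℂ) ^ (-m) * σ (xN N) ℓ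
    rw [hFr _ _ (hlat r hr ℓ hℓ), F0_eq m σ hhom _ r hr ℓ hℓ]
    · rfl
    · intro j
      simp [latt, div_eq_inv_mul]
    · rintro (i | j)
      · exact ⟨(⌊(N : ℝ) * x i⌋ : ℚ) / N, by simp [hxN]⟩
      · exact ⟨(r : ℚ)⁻¹ * ℓ j, by simp [latt]⟩
  have hsmooth : ContDiffOn ℝ (⊤ : ℕ∞)
      (fun p : (Fin n → ℝ) × (Fin n → ℝ) => F (Sum.elim p.1 p.2))
        (Set.univ ×ˢ {ξ : Fin n → ℝ | ξ ≠ 0}) := by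
    refine contDiffOn_infty.2 fun k => ?_
    have hlin : ContDiff ℝ k
        (fun p : (Fin n → ℝ) × (Fin n → ℝ) => (Sum.elim p.1 p.2 : Fin n ⊕ Fin n → ℝ)) := by
      refine contDiff_pi.2 ?_
      rintro (i | j)
      · exact (contDiff_apply ℝ ℝ i).comp contDiff_fst
      · exact (contDiff_apply ℝ ℝ j).comp contDiff_snd
    exact (Good.contDiffOn isOpen_U k hG).comp hlin.contDiffOn fun p hp => hp.2
  have hslice : ∀ τ : (Fin n → ℝ) → (Fin n → ℝ) → ℂ,
      ContinuousOn (fun p : (Fin n → ℝ) × (Fin n → ℝ) => τ p.1 p.2)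
        (Set.univ ×ˢ {ξ : Fin n → ℝ | ξ ≠ 0}) → ∀ x, ContinuousOn (τ x) {ξ | ξ ≠ 0} := by
    intro τ hτ x
    exact hτ.comp (f := fun ξ : Fin n → ℝ => (x, ξ)) (by fun_prop) fun ξ hξ => ⟨trivial, hξ⟩
  have hFs : ∀ x, ContinuousOn (fun ξ => F (Sum.elim x ξ)) {ξ | ξ ≠ 0} :=
    hslice (fun x ξ => F (Sum.elim x ξ)) hsmooth.continuousOn
  have hrat : ∀ (x : Fin n → ℝ) (a b : ℕ), 0 < a → 0 < b → ∀ ξ : Fin n → ℝ, ξ ≠ 0 →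
      F (Sum.elim x (((a : ℝ) / b) • ξ)) = (((a : ℝ) / b : ℝ) : ℂ) ^ m * F (Sum.elim x ξ) := by
    intro x a b ha hb ξ hξ
    have ha0 : (0 : ℝ) < a := by exact_mod_cast ha
    have hb0 : (0 : ℝ) < b := by exact_mod_cast hb
    refine eq_of_dense (fun ξ => F (Sum.elim x (((a : ℝ) / b) • ξ)))
      (fun ξ => (((a : ℝ) / b : ℝ) : ℂ) ^ m * F (Sum.elim x ξ)) ?_
      (continuousOn_const.mul (hFs x)) ?_ ξ hξ
    · refine (hFs x).comp (f := fun ξ : Fin n → ℝ => ((a : ℝ) / b) • ξ) (by fun_prop)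
        fun ξ hξ => smul_ne_zero (by positivity) hξ
    · intro r hr ℓ hℓ
      have e : ((a : ℝ) / b) • ((r : ℝ)⁻¹ • latt ℓ) = ((b * r : ℕ) : ℝ)⁻¹ • latt ((a : ℤ) • ℓ) := by
        ext j
        simp only [latt, Pi.smul_apply, smul_eq_mul, Nat.cast_mul, Int.cast_mul, Int.cast_natCast,
          mul_inv, div_eq_mul_inv]
        ring
      have haℓ : (a : ℤ) • ℓ ≠ 0 := smul_ne_zero (by exact_mod_cast ha.ne') hℓ
      show F (Sum.elim x (((a : ℝ) / b) • ((r : ℝ)⁻¹ • latt ℓ))) = _ * F (Sum.elim x _)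
      rw [e, key x (b * r) (Nat.mul_pos hb hr) _ haℓ, key x r hr ℓ hℓ, hhom x ℓ hℓ a ha]
      have h1 : ((b * r : ℕ) : ℂ) ^ (-m) = (b : ℂ) ^ (-m) * (r : ℂ) ^ (-m) := by
        rw [Nat.cast_mul, Complex.natCast_mul_natCast_cpow]
      have h2 : (((a : ℝ) / b : ℝ) : ℂ) ^ m * (b : ℂ) ^ m = (a : ℂ) ^ m := by
        have := Complex.mul_cpow_ofReal_nonneg (a := (a : ℝ) / b) (b := b) (by positivity)
          hb0.le m
        rw [← Complex.ofReal_mul, div_mul_cancel₀ _ hb0.ne'] at this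
        simpa using this.symm
      have h3 : (b : ℂ) ^ (-m) * (b : ℂ) ^ m = 1 := by
        rw [← Complex.cpow_add _ _ (by exact_mod_cast hb.ne')]
        simp
      rw [h1, ← h2]
      linear_combination ((((a : ℝ) / b : ℝ) : ℂ) ^ m * (r : ℂ) ^ (-m) * σ x ℓ) * h3
  have hhomt : ∀ (x : Fin n → ℝ) (t : ℝ), 0 < t → ∀ ξ : Fin n → ℝ, ξ ≠ 0 →
      F (Sum.elim x (t • ξ)) = (t : ℂ) ^ m * F (Sum.elim x ξ) := by
    intro x t ht ξ hξ
    have tt := nat_floor_tendsto t ht.le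
    have hm : t • ξ ≠ 0 := smul_ne_zero ht.ne' hξ
    have c1 : ContinuousAt (fun ξ => F (Sum.elim x ξ)) (t • ξ) :=
      (hFs x).continuousAt (isOpen_ne.mem_nhds hm)
    have T1 := c1.tendsto.comp (tt.smul_const ξ)
    have T2 := ((Complex.continuousAt_ofReal_cpow_const t m (Or.inr ht.ne')).tendsto.comp
      tt).mul_const (F (Sum.elim x ξ))
    refine tendsto_nhds_unique_of_eventuallyEq T1 T2 ?_
    filter_upwards [tt.eventually_const_lt ht, Filter.eventually_gt_atTop 0] with N h1 h2
    have hN : (0 : ℝ) < N := by exact_mod_cast h2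
    have h3 : 0 < ⌊(N : ℝ) * t⌋₊ := by
      rcases Nat.eq_zero_or_pos ⌊(N : ℝ) * t⌋₊ with h0 | h0
      · rw [h0] at h1
        simp at h1
      · exact h0
    exact hrat x _ N h3 h2 ξ hξ
  have hagree : ∀ (x : Fin n → ℝ) (ℓ : Fin n → ℤ), ℓ ≠ 0 → F (Sum.elim x (latt ℓ)) = σ x ℓ := by
    intro x ℓ hℓ
    have := key x 1 one_pos ℓ hℓ
    simpa using this
  refine ⟨fun x ξ => F (Sum.elim x ξ), ⟨hsmooth.continuousOn, ?_, hhomt, hagree⟩, hsmooth, ?_⟩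
  · intro x k ξ hξ
    refine eq_of_dense (fun ξ => F (Sum.elim (x + latt k) ξ)) (fun ξ => F (Sum.elim x ξ))
      (hFs _) (hFs _) ?_ ξ hξ
    intro r hr ℓ hℓ
    show F (Sum.elim (x + latt k) ((r : ℝ)⁻¹ • latt ℓ)) = F (Sum.elim x ((r : ℝ)⁻¹ • latt ℓ))
    rw [key _ r hr ℓ hℓ, key _ r hr ℓ hℓ, hper]
  · rintro τ ⟨hτc, -, hτh, hτa⟩ x ξ hξ
    refine eq_of_dense (τ x) (fun ξ => F (Sum.elim x ξ)) (hslice τ hτc x) (hFs x) ?_ ξ hξ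
    intro r hr ℓ hℓ
    have hr0 : (0 : ℝ) < (r : ℝ)⁻¹ := by
      have : (0 : ℝ) < r := by exact_mod_cast hr
      positivity
    have hl : latt ℓ ≠ 0 := by
      have := hlat 1 one_pos ℓ hℓ
      simpa using this
    show τ x ((r : ℝ)⁻¹ • latt ℓ) = F (Sum.elim x ((r : ℝ)⁻¹ • latt ℓ))
    rw [hτh x _ hr0 _ hl, hhomt x _ hr0 _ hl, hτa x ℓ hℓ, hagree x ℓ hℓ]
end

section
/- Let n ≥ 1 and let χ : ℝ^n → ℂ be a smooth compactly supported function such that χ ≡ 1 on a neighbourhood of 0 and supp χ ∩ ℤ^n = {0}. Then for every multi-index α ∈ ℕ^n with |α| ≥ 1 and every ξ ∈ ℝ^n, the series ∑_{ℓ ∈ ℤ^n} (ξ − ℓ)^α 𝓕χ(ℓ − ξ) converges absolutely and ∑_{ℓ ∈ ℤ^n} (ξ − ℓ)^α 𝓕χ(ℓ − ξ) = 0, where (ξ − ℓ)^α = ∏_{j=1}^n (ξ_j − ℓ_j)^{α_j}. -/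
open scoped BigOperators
open MeasureTheory

/-- The Fourier transform `𝓕g(ξ) = ∫ g(y) e^{-2πi y·ξ} dy` on `ℝ^n`. -/
noncomputable def FT {n : ℕ} (g : (Fin n → ℝ) → ℂ) (ξ : Fin n → ℝ) : ℂ :=
  ∫ y : Fin n → ℝ, g y * Complex.exp ((-(2 * Real.pi * ∑ i, y i * ξ i) : ℝ) * Complex.I)

/-- The exponential character `x ↦ e^{-2πi x·η}`. -/
noncomputable def chr {n : ℕ} (η : Fin n → ℝ) (y : Fin n → ℝ) : ℂ :=
  Complex.exp ((-(2 * Real.pi * ∑ i, y i * η i) : ℝ) * Complex.I)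

lemma chr_contDiff {n : ℕ} (η : Fin n → ℝ) : ContDiff ℝ (⊤ : ℕ∞) (chr η) := by
  unfold chr
  apply ContDiff.cexp
  apply ContDiff.mul _ contDiff_const
  have h : ContDiff ℝ (⊤ : ℕ∞) (fun y : Fin n → ℝ => -(2 * Real.pi * ∑ i, y i * η i)) := by
    fun_prop
  exact Complex.ofRealCLM.contDiff.comp h

lemma chr_norm {n : ℕ} (η : Fin n → ℝ) (y : Fin n → ℝ) : ‖chr η y‖ = 1 := by
  unfold chr
  exact Complex.norm_exp_ofReal_mul_I _

lemma chr_sub {n : ℕ} (η ξ : Fin n → ℝ) (y : Fin n → ℝ) :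
    chr (η - ξ) y = chr (-ξ) y * chr η y := by
  unfold chr
  rw [← Complex.exp_add, ← add_mul, ← Complex.ofReal_add]
  congr 3
  simp only [Pi.sub_apply, Pi.neg_apply, mul_sub, Finset.sum_sub_distrib, mul_neg,
    Finset.sum_neg_distrib]
  ring

lemma chr_fderiv {n : ℕ} (η : Fin n → ℝ) (y : Fin n → ℝ) (j : Fin n) :
    fderiv ℝ (chr η) y (Pi.single j 1) = -(2 * Real.pi * Complex.I * η j) * chr η y := by
  have h0 : HasFDerivAt (fun y : Fin n → ℝ => ∑ i, y i * η i)
      (∑ i, (η i) • (ContinuousLinearMap.proj i : (Fin n → ℝ) →L[ℝ] ℝ)) y := by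
    apply HasFDerivAt.fun_sum
    intro i _
    exact (hasFDerivAt_apply i y).mul_const (η i)
  have h1 := ((h0.const_mul (2 * Real.pi)).neg)
  have h2 := ((Complex.ofRealCLM.hasFDerivAt.comp y h1).mul_const Complex.I).cexp
  have h3 : HasFDerivAt (chr η) _ y := h2
  rw [h3.fderiv]
  simp [Pi.single_apply, chr]
  ring

lemma FT_eq {n : ℕ} (g : (Fin n → ℝ) → ℂ) (η : Fin n → ℝ) : FT g η = ∫ y, g y * chr η y := rfl

lemma int_chr {n : ℕ} {g : (Fin n → ℝ) → ℂ} (hg : Continuous g) (hc : HasCompactSupport g)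
    (η : Fin n → ℝ) : Integrable (fun y => g y * chr η y) :=
  (hg.mul (chr_contDiff η).continuous).integrable_of_hasCompactSupport hc.mul_right

/-- Normalised partial derivative. -/
noncomputable def MD {n : ℕ} (j : Fin n) (g : (Fin n → ℝ) → ℂ) : (Fin n → ℝ) → ℂ :=
  fun x => (-(2 * Real.pi * Complex.I)⁻¹) * fderiv ℝ g x (Pi.single j 1)

lemma MD_smooth {n : ℕ} (j : Fin n) {g : (Fin n → ℝ) → ℂ} (hg : ContDiff ℝ (⊤ : ℕ∞) g) :
    ContDiff ℝ (⊤ : ℕ∞) (MD j g) := by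
  unfold MD
  apply contDiff_const.mul
  exact (hg.fderiv_right (m := (⊤ : ℕ∞)) (by simp)).clm_apply contDiff_const

lemma MD_tsupport {n : ℕ} (j : Fin n) (g : (Fin n → ℝ) → ℂ) : tsupport (MD j g) ⊆ tsupport g := by
  refine subset_trans ?_ (tsupport_fderiv_apply_subset ℝ (f := g) (Pi.single j 1))
  exact tsupport_mul_subset_right

lemma MD_compact {n : ℕ} (j : Fin n) {g : (Fin n → ℝ) → ℂ} (hg : HasCompactSupport g) :
    HasCompactSupport (MD j g) :=
  hg.of_isClosed_subset (isClosed_tsupport _) (MD_tsupport j g)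

lemma MD_const {n : ℕ} (j : Fin n) {g : (Fin n → ℝ) → ℂ} {c : ℂ}
    (h : ∀ᶠ x in nhds (0 : Fin n → ℝ), g x = c) :
    ∀ᶠ x in nhds (0 : Fin n → ℝ), MD j g x = 0 := by
  filter_upwards [h.eventually_nhds] with x hx
  have : fderiv ℝ g x = 0 := by
    have h2 : g =ᶠ[nhds x] fun _ => c := hx
    rw [h2.fderiv_eq]; simp
  simp [MD, this]

lemma FT_MD {n : ℕ} (j : Fin n) {g : (Fin n → ℝ) → ℂ} (hg : ContDiff ℝ (⊤ : ℕ∞) g)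
    (hc : HasCompactSupport g) (η : Fin n → ℝ) : FT (MD j g) η = -(η j : ℂ) * FT g η := by
  have hD : ContDiff ℝ (⊤ : ℕ∞) (fun x => fderiv ℝ g x (Pi.single j 1)) :=
    (hg.fderiv_right (m := (⊤ : ℕ∞)) (by simp)).clm_apply contDiff_const
  have key := integral_mul_fderiv_eq_neg_fderiv_mul_of_integrable (μ := (volume : Measure (Fin n → ℝ)))
    (f := g) (g := chr η) (v := Pi.single j 1)
    (int_chr hD.continuous (hc.fderiv_apply ℝ _) η)
    (by
      simp_rw [chr_fderiv]
      have := (int_chr hg.continuous hc η).const_mul (-(2 * Real.pi * Complex.I * η j))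
      refine this.congr (Filter.Eventually.of_forall fun x => ?_)
      simp only []; ring)
    (int_chr hg.continuous hc η)
    (fun x _ => (hg.differentiable (by simp)).differentiableAt)
    (fun x _ => ((chr_contDiff η).differentiable (by simp)).differentiableAt)
  have h1 : ∫ x, g x * fderiv ℝ (chr η) x (Pi.single j 1)
      = -(2 * Real.pi * Complex.I * η j) * FT g η := by
    rw [FT_eq, ← integral_const_mul]
    congr 1; ext x; rw [chr_fderiv]; ring
  have h2 : FT (MD j g) η = (-(2 * Real.pi * Complex.I)⁻¹) *
      ∫ x, fderiv ℝ g x (Pi.single j 1) * chr η x := by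
    rw [FT_eq, ← integral_const_mul]
    congr 1; ext x; simp only [MD]; ring
  have h3 : ∫ x, fderiv ℝ g x (Pi.single j 1) * chr η x = (2 * Real.pi * Complex.I * η j) * FT g η := by
    rw [h1] at key
    have := neg_injective (key.symm.trans (neg_mul _ _))
    exact this
  rw [h2, h3]
  have : (2 * Real.pi * Complex.I : ℂ) ≠ 0 := Complex.two_pi_I_ne_zero
  field_simp

lemma exists_weight {n : ℕ} {χ : (Fin n → ℝ) → ℂ}
    (hχsm : ContDiff ℝ (⊤ : ℕ∞) χ) (hχc : HasCompactSupport χ)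
    (hχ1 : ∀ᶠ x in nhds (0 : Fin n → ℝ), χ x = 1) (m : ℕ) :
    ∀ α : Fin n → ℕ, ∑ j, α j = m → ∃ g : (Fin n → ℝ) → ℂ, ContDiff ℝ (⊤ : ℕ∞) g ∧
      HasCompactSupport g ∧ tsupport g ⊆ tsupport χ ∧
      (∀ᶠ x in nhds (0 : Fin n → ℝ), g x = if m = 0 then 1 else 0) ∧
      ∀ η, FT g η = (∏ j, (-(η j : ℂ)) ^ α j) * FT χ η := by
  induction m with
  | zero =>
    intro α hα
    refine ⟨χ, hχsm, hχc, subset_rfl, by simpa using hχ1, fun η => ?_⟩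
    have : ∀ j, α j = 0 := by simpa using hα
    simp [this]
  | succ m ih =>
    intro α hα
    obtain ⟨j, hj⟩ : ∃ j, α j ≠ 0 := by
      by_contra! h
      simp [h] at hα
    obtain ⟨β, hβ⟩ : ∃ β : Fin n → ℕ, α = β + Pi.single j 1 := by
      refine ⟨α - Pi.single j 1, ?_⟩
      ext i
      by_cases h : i = j
      · subst h; simp; omega
      · simp [h]
    subst hβ
    have hs : ∑ i, β i = m := by
      simp [Finset.sum_add_distrib] at hα
      exact hα
    obtain ⟨g, h1, h2, h3, h4, h5⟩ := ih β hs
    refine ⟨MD j g, MD_smooth j h1, MD_compact j h2, (MD_tsupport j g).trans h3,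
      by simpa using MD_const j h4, fun η => ?_⟩
    rw [FT_MD j h1 h2, h5]
    have : ∏ i, (-(η i : ℂ)) ^ (Pi.single j 1 : Fin n → ℕ) i = -(η j : ℂ) := by
      rw [Finset.prod_eq_single j]
      · simp
      · intro b _ hb; simp [hb]
      · simp
    simp only [Pi.add_apply, pow_add, Finset.prod_mul_distrib, this]
    ring

lemma exists_decay {n : ℕ} {h : (Fin n → ℝ) → ℂ}
    (hsm : ContDiff ℝ (⊤ : ℕ∞) h) (hc : HasCompactSupport h) (s : Finset (Fin n)) :
    ∃ g : (Fin n → ℝ) → ℂ, ContDiff ℝ (⊤ : ℕ∞) g ∧ HasCompactSupport g ∧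
      ∀ η, FT g η = (∏ j ∈ s, (1 + (η j : ℂ) ^ 2)) * FT h η := by
  classical
  induction s using Finset.induction_on with
  | empty => exact ⟨h, hsm, hc, by simp⟩
  | insert j s hj ih =>
    obtain ⟨g, h1, h2, h3⟩ := ih
    have s1 := MD_smooth j (MD_smooth j h1)
    have c1 := MD_compact j (MD_compact j h2)
    refine ⟨g + MD j (MD j g), h1.add s1, h2.add c1, fun η => ?_⟩
    have : FT (g + MD j (MD j g)) η = FT g η + FT (MD j (MD j g)) η := by
      simp only [FT_eq, Pi.add_apply, add_mul]
      exact integral_add (int_chr h1.continuous h2 η) (int_chr s1.continuous c1 η)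
    rw [this, FT_MD j (MD_smooth j h1) (MD_compact j h2), FT_MD j h1 h2, h3,
      Finset.prod_insert hj]
    ring

lemma summable_pi_prod {n : ℕ} {f : ℤ → ℝ} (hf : Summable f) (h0 : ∀ m, 0 ≤ f m) :
    Summable (fun ℓ : Fin n → ℤ => ∏ j, f (ℓ j)) := by
  classical
  refine summable_of_sum_le (c := ∏ _j : Fin n, ∑' m, f m)
    (fun ℓ => Finset.prod_nonneg fun j _ => h0 _) (fun u => ?_)
  let t : Fin n → Finset ℤ := fun j => u.image (fun ℓ => ℓ j)
  calc ∑ ℓ ∈ u, ∏ j, f (ℓ j) ≤ ∑ ℓ ∈ Fintype.piFinset t, ∏ j, f (ℓ j) := by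
        apply Finset.sum_le_sum_of_subset_of_nonneg
        · intro ℓ hℓ
          rw [Fintype.mem_piFinset]
          intro j
          exact Finset.mem_image_of_mem _ hℓ
        · intro ℓ _ _
          exact Finset.prod_nonneg fun j _ => h0 _
    _ = ∏ j, ∑ m ∈ t j, f m := (Finset.prod_univ_sum t (fun _ m => f m)).symm
    _ ≤ _ := Finset.prod_le_prod (fun j _ => Finset.sum_nonneg fun m _ => h0 m)
        (fun j _ => hf.sum_le_tsum _ (fun m _ => h0 m))

lemma summable_base : Summable (fun m : ℤ => (1 + (m : ℝ) ^ 2)⁻¹) := by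
  have h : Summable (fun m : ℤ => 1 / (m : ℝ) ^ 2) :=
    Real.summable_one_div_int_pow.mpr (by norm_num)
  refine Summable.of_norm_bounded_eventually h ?_
  have : ({0} : Set ℤ)ᶜ ∈ Filter.cofinite := (Set.finite_singleton 0).compl_mem_cofinite
  filter_upwards [this] with m hm
  have hm' : (m : ℝ) ≠ 0 := by exact_mod_cast hm
  have : 0 < (m : ℝ) ^ 2 := by positivity
  rw [Real.norm_of_nonneg (by positivity), one_div]
  exact inv_anti₀ this (by linarith)

lemma summable_FT {n : ℕ} {h : (Fin n → ℝ) → ℂ}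
    (hsm : ContDiff ℝ (⊤ : ℕ∞) h) (hc : HasCompactSupport h) :
    Summable (fun ℓ : Fin n → ℤ => ‖FT h (latt ℓ)‖) := by
  obtain ⟨g, h1, h2, h3⟩ := exists_decay hsm hc Finset.univ
  have hS := (summable_pi_prod (n := n) summable_base (fun m => by positivity)).mul_left
    (∫ y, ‖g y‖)
  refine Summable.of_nonneg_of_le (fun _ => norm_nonneg _) (fun ℓ => ?_) hS
  have hb : ‖FT g (latt ℓ)‖ ≤ ∫ y, ‖g y‖ := by
    rw [FT_eq]
    refine (norm_integral_le_integral_norm _).trans (le_of_eq ?_)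
    simp [chr_norm]
  have hp : 0 < ∏ j, (1 + (ℓ j : ℝ) ^ 2) := Finset.prod_pos fun j _ => by positivity
  have he : ‖FT g (latt ℓ)‖ = (∏ j, (1 + (ℓ j : ℝ) ^ 2)) * ‖FT h (latt ℓ)‖ := by
    rw [h3, norm_mul]
    congr 1
    rw [norm_prod]
    refine Finset.prod_congr rfl fun j _ => ?_
    have : (1 + ((latt ℓ j : ℝ) : ℂ) ^ 2) = ((1 + (ℓ j : ℝ) ^ 2 : ℝ) : ℂ) := by
      simp [latt]
    rw [this, Complex.norm_real, Real.norm_of_nonneg (by positivity)]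
  rw [he] at hb
  rw [Finset.prod_inv_distrib, ← div_eq_mul_inv, le_div_iff₀ hp]
  linarith

/-- Half open unit box. -/
def bx (n : ℕ) : Set (Fin n → ℝ) := {x | ∀ i, x i ∈ Set.Ioc ((0 : Fin n → ℝ) i) ((0 : Fin n → ℝ) i + 1)}

lemma bx_meas (n : ℕ) : MeasurableSet (bx n) := by
  unfold bx
  exact MeasurableSet.univ_pi' fun i => measurableSet_Ioc

lemma hasSum_bx {n : ℕ} {E : Type*} [NormedAddCommGroup E] [NormedSpace ℝ E] {f : (Fin n → ℝ) → E}
    (hf : Integrable f) :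
    HasSum (fun ℓ : Fin n → ℤ => ∫ x in bx n, f (x + latt ℓ)) (∫ x, f x) := by
  let s : (Fin n → ℤ) → Set (Fin n → ℝ) := fun ℓ => (fun x => x + -latt ℓ) ⁻¹' bx n
  have hU : ⋃ ℓ, s ℓ = Set.univ := by
    refine Set.eq_univ_of_forall fun x => Set.mem_iUnion.2 ⟨fun i => ⌈x i⌉ - 1, fun i => ?_⟩
    have := Int.ceil_lt_add_one (x i)
    have := Int.le_ceil (x i)
    simp [latt]
    constructor <;> linarith
  have hd : Pairwise (Function.onFun Disjoint s) := by
    intro ℓ m hne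
    refine Set.disjoint_left.2 fun x hx hy => hne ?_
    ext i
    have h1 := hx i
    have h2 := hy i
    simp [latt] at h1 h2
    have a1 : (ℓ i : ℝ) < m i + 1 := by linarith [h1.1, h2.2]
    have a2 : (m i : ℝ) < ℓ i + 1 := by linarith [h1.2, h2.1]
    have : ℓ i < m i + 1 := by exact_mod_cast a1
    have : m i < ℓ i + 1 := by exact_mod_cast a2
    omega
  have := hasSum_integral_iUnion (f := f) (μ := volume) (s := s)
    (fun ℓ => (measurable_id.add_const _) (bx_meas n)) hd (by rw [hU]; exact hf.integrableOn)
  rw [hU, setIntegral_univ] at this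
  refine this.congr_fun fun ℓ => ?_
  have hp := (measurePreserving_add_right (volume : Measure (Fin n → ℝ)) (-latt ℓ)).setIntegral_preimage_emb
    (measurableEmbedding_addRight _) (fun x => f (x + latt ℓ)) (bx n)
  rw [← hp]
  simp [s]

lemma poisson {n : ℕ} {h : (Fin n → ℝ) → ℂ}
    (hsm : Continuous h) (hc : HasCompactSupport h)
    (hS : Summable (fun ℓ : Fin n → ℤ => ‖FT h (latt ℓ)‖)) (h0 : ∀ ℓ : Fin n → ℤ, h (latt ℓ) = 0) :
    ∑' ℓ : Fin n → ℤ, FT h (latt ℓ) = 0 := by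
  have hfin : LocallyFinite (fun ℓ : Fin n → ℤ => Function.support fun x => h (x + latt ℓ)) := by
    intro x0
    obtain ⟨R, hR⟩ := hc.isBounded.exists_norm_le
    refine ⟨Metric.ball x0 1, Metric.ball_mem_nhds _ one_pos, ?_⟩
    refine (Set.finite_Icc (fun _ : Fin n => -⌈R + ‖x0‖ + 1⌉) (fun _ => ⌈R + ‖x0‖ + 1⌉)).subset ?_
    rintro ℓ ⟨x, hx, hxb⟩
    have e1 : ‖x + latt ℓ‖ ≤ R := hR _ (subset_tsupport _ hx)
    have e2 : ‖x - x0‖ < 1 := by simpa [dist_eq_norm] using hxb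
    have e3 : ‖latt ℓ‖ ≤ R + ‖x0‖ + 1 := by
      have : latt ℓ = (x + latt ℓ) - (x - x0) - x0 := by abel
      rw [this]
      have := norm_sub_le ((x + latt ℓ) - (x - x0)) x0
      have := norm_sub_le (x + latt ℓ) (x - x0)
      linarith
    have e4 : ∀ i, |(ℓ i : ℝ)| ≤ ⌈R + ‖x0‖ + 1⌉ := fun i =>
      ((norm_le_pi_norm (latt ℓ) i).trans e3).trans (Int.le_ceil _)
    constructor <;> intro i <;> have := abs_le.1 (e4 i)
    · have := this.1; exact_mod_cast this
    · have := this.2; exact_mod_cast this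
  let G : (Fin n → ℝ) → ℂ := fun x => ∑ᶠ ℓ : Fin n → ℤ, h (x + latt ℓ)
  have hGc : Continuous G := continuous_finsum (fun ℓ => by fun_prop) hfin
  have hGt : ∀ x, G x = ∑' ℓ : Fin n → ℤ, h (x + latt ℓ) := fun x =>
    (tsum_eq_finsum (hfin.point_finite x)).symm
  have hGp : ∀ x (m : Fin n → ℤ), G (x + latt m) = G x := by
    intro x m
    rw [hGt, hGt, ← (Equiv.addLeft m).tsum_eq (fun ℓ => h (x + latt ℓ))]
    refine tsum_congr fun ℓ => ?_
    congr 1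
    ext i
    simp [latt, add_assoc]
  let π : C(Fin n → ℝ, UnitAddTorus (Fin n)) :=
    ⟨Pi.map fun _ (x : ℝ) => (x : UnitAddCircle), by
      exact Continuous.piMap fun i => AddCircle.continuous_mk' 1⟩
  have hπ : Topology.IsQuotientMap π :=
    (IsOpenQuotientMap.piMap (f := fun (_ : Fin n) (x : ℝ) => (x : UnitAddCircle))
      fun i => QuotientAddGroup.isOpenQuotientMap_mk).isQuotientMap
  have hfac : Function.FactorsThrough (⟨G, hGc⟩ : C(Fin n → ℝ, ℂ)) π := by
    intro a b hab
    have : ∀ i, ∃ m : ℤ, a i = b i + m := by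
      intro i
      have hi : ((a i : ℝ) : UnitAddCircle) = (b i : ℝ) := congrFun hab i
      have h2 := QuotientAddGroup.eq_iff_sub_mem.1 hi
      obtain ⟨m, hm⟩ := AddSubgroup.mem_zmultiples_iff.1 h2
      refine ⟨m, ?_⟩
      simp at hm
      linarith
    choose m hm using this
    have : a = b + latt m := funext hm
    simp [this, hGp]
  let F : C(UnitAddTorus (Fin n), ℂ) := hπ.lift ⟨G, hGc⟩ hfac
  have hFπ : ∀ x, F (π x) = G x := fun x => congrArg (fun q : C(Fin n → ℝ, ℂ) => q x) (hπ.lift_comp ⟨G, hGc⟩ hfac)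
  have hcoef : ∀ m : Fin n → ℤ, UnitAddTorus.mFourierCoeff F m = FT h (latt m) := by
    intro m
    have hI := int_chr hsm hc (latt m)
    have hper : ∀ x (ℓ : Fin n → ℤ), chr (latt m) (x + latt ℓ) = chr (latt m) x := by
      intro x ℓ
      unfold chr
      rw [Complex.exp_eq_exp_iff_exists_int]
      refine ⟨-∑ i, ℓ i * m i, ?_⟩
      simp [latt, add_mul, Finset.sum_add_distrib]
      ring
    have hm1 : ∀ x : Fin n → ℝ, UnitAddTorus.mFourier (-m) (π x) = chr (latt m) x := by
      intro x
      simp only [UnitAddTorus.mFourier, ContinuousMap.coe_mk, π, Pi.map_apply, fourier_coe_apply,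
        chr]
      rw [← Complex.exp_sum]
      congr 1
      simp [latt, Finset.mul_sum, Finset.sum_mul]
      refine Finset.sum_congr rfl fun i _ => ?_
      ring
    rw [UnitAddTorus.mFourierCoeff_eq_integral F m 0]
    have e1 := (hasSum_bx hI)
    have e2 := (hasSum_bx hI.norm).summable
    have e3 := hasSum_integral_of_summable_integral_norm (μ := volume.restrict (bx n))
      (F := fun (ℓ : Fin n → ℤ) x => h (x + latt ℓ) * chr (latt m) (x + latt ℓ))
      (fun ℓ => (hI.comp_add_right (latt ℓ)).integrableOn) e2
    rw [FT_eq, e1.unique e3]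
    refine integral_congr_ae (Filter.Eventually.of_forall fun x => ?_)
    have hx1 : UnitAddTorus.mFourier (-m) (fun i => ((x i : ℝ) : UnitAddCircle)) = chr (latt m) x :=
      hm1 x
    have hx2 : F (fun i => ((x i : ℝ) : UnitAddCircle)) = G x := hFπ x
    simp only [hx1, hx2, hper, smul_eq_mul]
    rw [hGt, tsum_mul_right, mul_comm]
  have hsum : Summable (UnitAddTorus.mFourierCoeff F) := by
    have : UnitAddTorus.mFourierCoeff F = fun ℓ => FT h (latt ℓ) := funext hcoef
    rw [this]
    exact hS.of_norm
  have hfinal := UnitAddTorus.hasSum_mFourier_series_apply_of_summable hsum (π 0)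
  rw [hFπ] at hfinal
  have hG0 : G 0 = 0 := by simp [G, h0]
  rw [hG0] at hfinal
  rw [← hfinal.tsum_eq]
  refine tsum_congr fun m => ?_
  have : UnitAddTorus.mFourier m (π 0) = 1 := by
    simp [UnitAddTorus.mFourier, π, Pi.map]
  rw [hcoef, this, smul_eq_mul, mul_one]

/-- Poisson-type summation with a monomial weight: if `χ` is smooth, compactly supported,
`χ ≡ 1` near `0` and `supp χ ∩ ℤ^n = {0}`, then for every multi-index `α` with `|α| ≥ 1`,
`∑_{ℓ ∈ ℤ^n} (ξ - ℓ)^α 𝓕χ(ℓ - ξ) = 0` for every `ξ`, the series being absolutely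
convergent. -/
theorem poisson_sum_weighted_eq_zero (n : ℕ) (hn : 1 ≤ n) (χ : (Fin n → ℝ) → ℂ)
    (hχsm : ContDiff ℝ (⊤ : ℕ∞) χ) (hχc : HasCompactSupport χ)
    (hχ1 : ∀ᶠ x in nhds (0 : Fin n → ℝ), χ x = 1)
    (hχsupp : ∀ ℓ : Fin n → ℤ, ℓ ≠ 0 → latt ℓ ∉ tsupport χ)
    (α : Fin n → ℕ) (hα : 1 ≤ ∑ j, α j) :
    ∀ ξ : Fin n → ℝ,
      Summable (fun ℓ : Fin n → ℤ =>
        ‖((∏ j, (ξ j - (ℓ j : ℝ)) ^ α j : ℝ) : ℂ) * FT χ (latt ℓ - ξ)‖) ∧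
      ∑' ℓ : Fin n → ℤ,
        ((∏ j, (ξ j - (ℓ j : ℝ)) ^ α j : ℝ) : ℂ) * FT χ (latt ℓ - ξ) = 0 := by
  intro ξ
  obtain ⟨g, h1, h2, h3, h4, h5⟩ := exists_weight hχsm hχc hχ1 _ α rfl
  rw [if_neg (by omega)] at h4
  have hterm : ∀ ℓ : Fin n → ℤ,
      ((∏ j, (ξ j - (ℓ j : ℝ)) ^ α j : ℝ) : ℂ) * FT χ (latt ℓ - ξ)
        = FT (fun x => g x * chr (-ξ) x) (latt ℓ) := by
    intro ℓ
    have e : FT (fun x => g x * chr (-ξ) x) (latt ℓ) = FT g (latt ℓ - ξ) := by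
      simp only [FT_eq, chr_sub, mul_assoc]
    rw [e, h5]
    simp [latt]
  simp only [hterm]
  have hs := h1.mul (chr_contDiff (-ξ))
  have hc : HasCompactSupport (fun x => g x * chr (-ξ) x) := h2.mul_right
  have hS := summable_FT hs hc
  refine ⟨hS, poisson hs.continuous hc hS fun ℓ => ?_⟩
  by_cases hℓ : ℓ = 0
  · have : latt ℓ = 0 := by ext i; simp [hℓ, latt]
    simp [this, h4.self_of_nhds]
  · have : g (latt ℓ) = 0 := image_eq_zero_of_notMem_tsupport fun h => hχsupp ℓ hℓ (h3 h)
    simp [this]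
end
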